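/- arXiv:1804.11172 — 8 statements merged into one kernel-verified Lean document; each statement's English description precedes it below -/
import Mathlib

section
/- Let q be a prime power, let V = GF(q)^v, let 𝒢 be a (g-1)-spread of V with g ≥ 2, and let L be a 2-dimensional subspace of V that is not contained in any element of 𝒢. Then the number of 3-dimensional subspaces B of V with L ≤ B such that B is scattered with respect to 𝒢 equals [v-2 choose 1]_q − [2 choose 1]_q · [g-1 choose 1]_q, where [n choose m]_q denotes the Gaussian binomial coefficient. -/
def gaussBinom (q n m : ℕ) : ℕ :=
  (∏ i ∈ Finset.range m, (q ^ (n - i) - 1)) / ∏ i ∈ Finset.range m, (q ^ (m - i) - 1)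

def IsSpread (F : Type*) {V : Type*} [Field F] [AddCommGroup V] [Module F V]
    (g : ℕ) (𝒢 : Set (Submodule F V)) : Prop :=
  (∀ S ∈ 𝒢, Module.finrank F S = g) ∧
    ∀ P : Submodule F V, Module.finrank F P = 1 → ∃! S, S ∈ 𝒢 ∧ P ≤ S

def IsScattered (F : Type*) {V : Type*} [Field F] [AddCommGroup V] [Module F V]
    (𝒢 : Set (Submodule F V)) (B : Submodule F V) : Prop :=
  ∀ S ∈ 𝒢, Module.finrank F ↥(B ⊓ S) ≤ 1

def IsGDD (F : Type*) {V : Type*} [Field F] [AddCommGroup V] [Module F V]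
    (g k lam : ℕ) (𝒢 ℬ : Set (Submodule F V)) : Prop :=
  IsSpread F g 𝒢 ∧ 1 < 𝒢.ncard ∧ (∀ B ∈ ℬ, Module.finrank F B = k) ∧
    ∀ L : Submodule F V, Module.finrank F L = 2 →
      ((∃ S ∈ 𝒢, L ≤ S) → (∃! S, S ∈ 𝒢 ∧ L ≤ S) ∧ ∀ B ∈ ℬ, ¬ L ≤ B) ∧
      ((¬ ∃ S ∈ 𝒢, L ≤ S) → {B ∈ ℬ | L ≤ B}.ncard = lam)

def IsSubspaceDesign (F : Type*) {V : Type*} [Field F] [AddCommGroup V] [Module F V]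
    (k lam : ℕ) (ℬ : Set (Submodule F V)) : Prop :=
  (∀ B ∈ ℬ, Module.finrank F B = k) ∧
    ∀ L : Submodule F V, Module.finrank F L = 2 → {B ∈ ℬ | L ≤ B}.ncard = lam

def IsFat (F : Type*) {E : Type*} [Field F] [Field E] [Algebra F E] {s : ℕ}
    (U : Submodule F (Fin s → E)) : Prop :=
  Module.finrank E (Submodule.span E (U : Set (Fin s → E))) = Module.finrank F U

def DesargSpread (F : Type*) (E : Type*) [Field F] [Field E] [Algebra F E] (s : ℕ) :
    Set (Submodule F (Fin s → E)) :=
  {S | ∃ W : Submodule E (Fin s → E), Module.finrank E W = 1 ∧ S = W.restrictScalars F}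

def slMap (F : Type*) {E : Type*} [Field F] [Field E] [Algebra F E] {s : ℕ}
    (A : Matrix.SpecialLinearGroup (Fin s) E) (U : Submodule F (Fin s → E)) :
    Submodule F (Fin s → E) :=
  U.map (LinearMap.restrictScalars F (Matrix.toLin' (A : Matrix (Fin s) (Fin s) E)))

open Module

section SpreadCounting

variable {F V : Type*} [Field F] [AddCommGroup V] [Module F V]

/-- Counting the vectors outside `L` covered by a family of `n`-dimensional subspaces that contain
`L` and meet pairwise inside `L`. -/
theorem ncard_covered_outside [Fintype F] [Finite V] {ι : Type*} {T : Set ι} (hT : T.Finite)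
    (A : ι → Submodule F V) (L : Submodule F V) (n : ℕ)
    (hLA : ∀ i ∈ T, L ≤ A i) (hn : ∀ i ∈ T, finrank F (A i) = n)
    (hpair : ∀ i ∈ T, ∀ j ∈ T, i ≠ j → A i ⊓ A j ≤ L) :
    ({x : V | x ∉ L ∧ ∃ i ∈ T, x ∈ A i}.ncard : ℤ) =
      T.ncard * ((Fintype.card F : ℤ) ^ n - (Fintype.card F : ℤ) ^ finrank F L) := by
  classical
  have := Fintype.ofFinite V
  have hcard (W : Submodule F V) : (W : Set V).ncard = Fintype.card F ^ finrank F W := by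
    rw [← Nat.card_eq_fintype_card, ← Module.natCard_eq_pow_finrank]
    rfl
  have hdiff : ∀ i ∈ hT.toFinset, (((A i : Set V) \ L).toFinset.card : ℤ) =
      (Fintype.card F : ℤ) ^ n - (Fintype.card F : ℤ) ^ finrank F L := by
    intro i hi
    rw [Set.Finite.mem_toFinset] at hi
    have h := Set.ncard_sdiff_add_ncard_of_subset
      (show (L : Set V) ⊆ A i from hLA i hi) (Set.toFinite _)
    rw [hcard, hcard, hn i hi] at h
    rw [← Set.ncard_eq_toFinset_card', eq_sub_iff_add_eq]
    exact_mod_cast h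
  have hset : {x : V | x ∉ L ∧ ∃ i ∈ T, x ∈ A i} =
      (hT.toFinset.biUnion fun i => ((A i : Set V) \ L).toFinset : Finset V) := by
    ext x
    simp only [Set.mem_ofPred_eq, Finset.coe_biUnion, Set.mem_iUnion, Set.coe_toFinset,
      Set.mem_sdiff, SetLike.mem_coe, Set.Finite.mem_toFinset]
    tauto
  rw [hset, Set.ncard_coe_finset, Finset.card_biUnion, Nat.cast_sum, Finset.sum_congr rfl hdiff,
    Finset.sum_const, nsmul_eq_mul, Set.ncard_eq_toFinset_card T hT]
  intro i hi j hj hij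
  rw [Finset.mem_coe, Set.Finite.mem_toFinset] at hi hj
  rw [Function.onFun, Finset.disjoint_left]
  intro x hxi hxj
  simp only [Set.mem_toFinset, Set.mem_sdiff, SetLike.mem_coe] at hxi hxj
  exact hxi.2 (hpair i hi j hj hij ⟨hxi.1, hxj.1⟩)

theorem IsSpread.inf_eq_bot {g : ℕ} {𝒢 : Set (Submodule F V)} (hG : IsSpread F g 𝒢)
    {S S' : Submodule F V} (hS : S ∈ 𝒢) (hS' : S' ∈ 𝒢) (hne : S ≠ S') : S ⊓ S' = ⊥ := by
  by_contra h
  obtain ⟨x, hx, hx0⟩ := Submodule.exists_mem_ne_zero_of_ne_bot h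
  refine hne ((hG.2 (F ∙ x) (finrank_span_singleton hx0)).unique ⟨hS, ?_⟩ ⟨hS', ?_⟩)
  · exact (Submodule.span_singleton_le_iff_mem x S).2 hx.1
  · exact (Submodule.span_singleton_le_iff_mem x S').2 hx.2

theorem IsSpread.exists_mem {g : ℕ} {𝒢 : Set (Submodule F V)} (hG : IsSpread F g 𝒢)
    {x : V} (hx : x ≠ 0) : ∃ S ∈ 𝒢, x ∈ S := by
  obtain ⟨S, ⟨hS, hxS⟩, -⟩ := hG.2 (F ∙ x) (finrank_span_singleton hx)
  exact ⟨S, hS, (Submodule.span_singleton_le_iff_mem x S).1 hxS⟩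

variable [FiniteDimensional F V]

theorem finrank_sup_span_singleton_of_notMem {L : Submodule F V} {x : V} (hx : x ∉ L) :
    finrank F ↥(L ⊔ F ∙ x) = finrank F L + 1 := by
  have hx0 : x ≠ 0 := fun h => hx (h ▸ L.zero_mem)
  have h := Submodule.finrank_sup_add_finrank_inf_eq L (F ∙ x)
  have hbot : L ⊓ F ∙ x = ⊥ := ((Submodule.disjoint_span_singleton' hx0).2 hx).eq_bot
  rwa [hbot, finrank_bot, finrank_span_singleton hx0, add_zero] at h

theorem finrank_inf_eq_one_of_not_le {L S : Submodule F V} (hL : finrank F L = 2)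
    (hLS : ¬ L ≤ S) (h : S ⊓ L ≠ ⊥) : finrank F ↥(S ⊓ L) = 1 := by
  have h1 : 1 ≤ finrank F ↥(S ⊓ L) := Submodule.one_le_finrank_iff.2 h
  have h2 : finrank F ↥(S ⊓ L) < finrank F L :=
    Submodule.finrank_lt_finrank_of_lt (inf_lt_right.2 hLS)
  omega

theorem finrank_inf_eq_two_of_le_sup {L S B : Submodule F V} (hL : finrank F L = 2)
    (hB : finrank F B = 3) (hLB : L ≤ B) (hSL : finrank F ↥(S ⊓ L) = 1) (hBS : B ≤ S ⊔ L) :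
    finrank F ↥(B ⊓ S) = 2 := by
  have hsup : L ⊔ B ⊓ S = B := by
    rw [inf_comm, ← sup_inf_assoc_of_le S hLB, sup_comm L S]
    exact inf_eq_right.2 hBS
  have hinf : L ⊓ (B ⊓ S) = S ⊓ L := by
    rw [← inf_assoc, inf_eq_left.2 hLB, inf_comm]
  have h := Submodule.finrank_sup_add_finrank_inf_eq L (B ⊓ S)
  rw [hsup, hinf] at h
  omega

theorem le_sup_of_two_le_finrank_inf {L S B : Submodule F V} (hL : finrank F L = 2)
    (hLS : ¬ L ≤ S) (hB : finrank F B = 3) (hLB : L ≤ B) (hBS : 2 ≤ finrank F ↥(B ⊓ S)) :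
    S ⊓ L ≠ ⊥ ∧ B ≤ S ⊔ L := by
  have hinf : L ⊓ (B ⊓ S) = S ⊓ L := by
    rw [← inf_assoc, inf_eq_left.2 hLB, inf_comm]
  have h := Submodule.finrank_sup_add_finrank_inf_eq L (B ⊓ S)
  have hle : L ⊔ B ⊓ S ≤ B := sup_le hLB inf_le_left
  have hle' := Submodule.finrank_mono hle
  rw [hinf] at h
  have hne : S ⊓ L ≠ ⊥ := Submodule.one_le_finrank_iff.1 (by omega)
  have h1 := finrank_inf_eq_one_of_not_le hL hLS hne
  refine ⟨hne, ?_⟩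
  rw [← Submodule.eq_of_le_of_finrank_le hle (by omega), sup_comm S L]
  exact sup_le_sup_left inf_le_right L

/-- The subspaces `S ⊔ L`, for spread elements `S` meeting `L`, meet pairwise inside `L`. -/
theorem IsSpread.sup_inf_sup_le {g : ℕ} {𝒢 : Set (Submodule F V)} (hG : IsSpread F g 𝒢)
    {L S S' : Submodule F V} (hL : finrank F L = 2) (hS : S ∈ 𝒢) (hS' : S' ∈ 𝒢) (hne : S ≠ S')
    (hSL : finrank F ↥(S ⊓ L) = 1) (hSL' : finrank F ↥(S' ⊓ L) = 1) :
    (S ⊔ L) ⊓ (S' ⊔ L) ≤ L := by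
  rintro x ⟨hx, hx'⟩
  by_contra hxL
  have hB : finrank F ↥(L ⊔ F ∙ x) = 3 := by rw [finrank_sup_span_singleton_of_notMem hxL, hL]
  have hBS {W : Submodule F V} (h : x ∈ W ⊔ L) : L ⊔ F ∙ x ≤ W ⊔ L :=
    sup_le le_sup_right ((Submodule.span_singleton_le_iff_mem x _).2 h)
  have h2 := finrank_inf_eq_two_of_le_sup hL hB le_sup_left hSL (hBS hx)
  have h2' := finrank_inf_eq_two_of_le_sup hL hB le_sup_left hSL' (hBS hx')
  have h := Submodule.finrank_sup_add_finrank_inf_eq ((L ⊔ F ∙ x) ⊓ S) ((L ⊔ F ∙ x) ⊓ S')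
  have hbot : (L ⊔ F ∙ x) ⊓ S ⊓ ((L ⊔ F ∙ x) ⊓ S') = ⊥ :=
    le_bot_iff.1 ((inf_le_inf inf_le_right inf_le_right).trans (hG.inf_eq_bot hS hS' hne).le)
  have hle : finrank F ↥((L ⊔ F ∙ x) ⊓ S ⊔ (L ⊔ F ∙ x) ⊓ S') ≤ finrank F ↥(L ⊔ F ∙ x) :=
    Submodule.finrank_mono (sup_le inf_le_left inf_le_left)
  rw [hbot, finrank_bot] at h
  omega

/-- A vector outside `L` spans with `L` a scattered subspace unless it lies in `S ⊔ L` for some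
spread element `S` meeting `L`. -/
theorem not_isScattered_sup_span_iff {𝒢 : Set (Submodule F V)} {L : Submodule F V}
    (hL : finrank F L = 2) (hLnc : ¬ ∃ S ∈ 𝒢, L ≤ S) {x : V} (hx : x ∉ L) :
    ¬ IsScattered F 𝒢 (L ⊔ F ∙ x) ↔ ∃ S ∈ {S ∈ 𝒢 | S ⊓ L ≠ ⊥}, x ∈ S ⊔ L := by
  have hB : finrank F ↥(L ⊔ F ∙ x) = 3 := by rw [finrank_sup_span_singleton_of_notMem hx, hL]
  constructor
  · intro h
    simp only [IsScattered, not_forall, not_le] at h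
    obtain ⟨S, hS, h2⟩ := h
    obtain ⟨hne, hle⟩ := le_sup_of_two_le_finrank_inf hL (fun h => hLnc ⟨S, hS, h⟩) hB
      le_sup_left h2
    exact ⟨S, ⟨hS, hne⟩, hle (le_sup_right (a := L) (Submodule.mem_span_singleton_self x))⟩
  · rintro ⟨S, ⟨hS, hne⟩, hxS⟩ hsc
    have h1 := finrank_inf_eq_one_of_not_le hL (fun h => hLnc ⟨S, hS, h⟩) hne
    have h2 := finrank_inf_eq_two_of_le_sup hL hB le_sup_left h1
      (sup_le le_sup_right ((Submodule.span_singleton_le_iff_mem x _).2 hxS))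
    have := hsc S hS
    omega

end SpreadCounting

theorem sub_one_mul_gaussBinom_one {q : ℕ} (hq : 1 < q) (n : ℕ) :
    ((q : ℤ) - 1) * gaussBinom q n 1 = (q : ℤ) ^ n - 1 := by
  have h : (q - 1) * gaussBinom q n 1 = q ^ n - 1 := by
    simpa [gaussBinom] using Nat.mul_div_cancel' (Nat.sub_one_dvd_pow_sub_one q n)
  have hpow : 1 ≤ q ^ n := Nat.one_le_pow _ _ (by omega)
  zify [hpow, hq.le] at h
  exact h

theorem stmt_0 (F : Type) [Field F] [Fintype F] (v g : ℕ) (hg : 2 ≤ g)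
    (𝒢 : Set (Submodule F (Fin v → F))) (hG : IsSpread F g 𝒢)
    (L : Submodule F (Fin v → F)) (hL : Module.finrank F L = 2)
    (hLnc : ¬ ∃ S ∈ 𝒢, L ≤ S) :
    ({B : Submodule F (Fin v → F) |
        Module.finrank F B = 3 ∧ L ≤ B ∧ IsScattered F 𝒢 B}.ncard : ℤ) =
      (gaussBinom (Fintype.card F) (v - 2) 1 : ℤ) -
        (gaussBinom (Fintype.card F) 2 1 : ℤ) *
          (gaussBinom (Fintype.card F) (g - 1) 1 : ℤ) := by
  classical
  set q := Fintype.card F with hqdef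
  have hq : 1 < q := Fintype.one_lt_card
  set T : Set (Submodule F (Fin v → F)) := {S ∈ 𝒢 | S ⊓ L ≠ ⊥} with hTdef
  set 𝒮 := {B : Submodule F (Fin v → F) | finrank F B = 3 ∧ L ≤ B ∧ IsScattered F 𝒢 B}
  have hone : ∀ S ∈ T, finrank F ↥(S ⊓ L) = 1 := fun S hS =>
    finrank_inf_eq_one_of_not_le hL (fun h => hLnc ⟨S, hS.1, h⟩) hS.2
  have hmeet : (q : ℤ) ^ 2 - 1 = T.ncard * ((q : ℤ) - 1) := by
    have h := ncard_covered_outside (Set.toFinite T) (fun S => S ⊓ L) ⊥ 1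
      (fun _ _ => bot_le) hone (fun S hS S' hS' hne => by
        rw [← hG.inf_eq_bot hS.1 hS'.1 hne]
        exact inf_le_inf inf_le_left inf_le_left)
    have hall := ncard_covered_outside (Set.finite_univ (α := Unit)) (fun _ => L) ⊥ 2
      (fun _ _ => bot_le) (fun _ _ => hL) (fun _ _ _ _ hne => (hne rfl).elim)
    have hset : {x : Fin v → F | x ∉ (⊥ : Submodule F (Fin v → F)) ∧ ∃ S ∈ T, x ∈ S ⊓ L} =
        {x | x ∉ (⊥ : Submodule F (Fin v → F)) ∧ ∃ i ∈ (Set.univ : Set Unit), x ∈ L} := by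
      ext x
      simp only [Set.mem_ofPred_eq, Submodule.mem_bot]
      refine and_congr_right fun hx0 => ⟨fun ⟨S, _, hx⟩ => ⟨(), trivial, hx.2⟩, ?_⟩
      rintro ⟨-, -, hxL⟩
      obtain ⟨S, hS, hxS⟩ := hG.exists_mem hx0
      exact ⟨S, ⟨hS, (Submodule.ne_bot_iff _).2 ⟨x, ⟨hxS, hxL⟩, hx0⟩⟩, hxS, hxL⟩
    rw [hset, hall] at h
    simpa using h
  have hbad := ncard_covered_outside (Set.toFinite T) (fun S => S ⊔ L) L (g + 1)
    (fun _ _ => le_sup_right) (fun S hS => by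
      have h := Submodule.finrank_sup_add_finrank_inf_eq S L
      rw [hone S hS, hL, hG.1 S hS.1] at h
      omega)
    (fun S hS S' hS' hne =>
      hG.sup_inf_sup_le hL hS.1 hS'.1 hne (hone S hS) (hone S' hS'))
  have hgood := ncard_covered_outside (Set.toFinite 𝒮) id L 3
    (fun B hB => hB.2.1) (fun B hB => hB.1) (fun B hB B' hB' hne => by
      have hlt : finrank F ↥(B ⊓ B') < finrank F B := by
        refine Submodule.finrank_lt_finrank_of_lt (inf_lt_left.2 fun hle => hne ?_)
        exact Submodule.eq_of_le_of_finrank_eq hle (hB.1.trans hB'.1.symm)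
      rw [hB.1] at hlt
      exact (Submodule.eq_of_le_of_finrank_le (le_inf hB.2.1 hB'.2.1) (by omega)).ge)
  have htotal := ncard_covered_outside (Set.finite_univ (α := Unit))
    (fun _ => (⊤ : Submodule F (Fin v → F))) L v
    (fun _ _ => le_top) (fun _ _ => by simp) (fun _ _ _ _ hne => (hne rfl).elim)
  have hscat {x : Fin v → F} (hx : x ∉ L) :
      (∃ B ∈ 𝒮, x ∈ id B) ↔ IsScattered F 𝒢 (L ⊔ F ∙ x) := by
    have h3 : finrank F ↥(L ⊔ F ∙ x) = 3 := by rw [finrank_sup_span_singleton_of_notMem hx, hL]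
    constructor
    · rintro ⟨B, ⟨hB, hLB, hsc⟩, hxB⟩
      have hle : L ⊔ F ∙ x ≤ B := sup_le hLB ((Submodule.span_singleton_le_iff_mem x B).2 hxB)
      rwa [Submodule.eq_of_le_of_finrank_eq hle (h3.trans hB.symm)]
    · exact fun h => ⟨_, ⟨h3, le_sup_left, h⟩,
        le_sup_right (a := L) (Submodule.mem_span_singleton_self x)⟩
  have hsplit : {x : Fin v → F | x ∉ L ∧ ∃ i ∈ (Set.univ : Set Unit),
        x ∈ (⊤ : Submodule F (Fin v → F))} =
      {x | x ∉ L ∧ ∃ B ∈ 𝒮, x ∈ id B} ∪ {x | x ∉ L ∧ ∃ S ∈ T, x ∈ S ⊔ L} := by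
    ext x
    by_cases hx : x ∈ L
    · simp [hx]
    · have h := not_isScattered_sup_span_iff hL hLnc hx
      rw [← hscat hx] at h
      simp only [Set.mem_union, Set.mem_ofPred_eq, hx, not_false_eq_true, true_and, ← hTdef] at h ⊢
      rw [← h]
      exact iff_of_true ⟨(), trivial, trivial⟩ (em _)
  have hdisj : Disjoint {x | x ∉ L ∧ ∃ B ∈ 𝒮, x ∈ id B} {x | x ∉ L ∧ ∃ S ∈ T, x ∈ S ⊔ L} := by
    rw [Set.disjoint_left]
    rintro x ⟨hx, hB⟩ ⟨-, hS⟩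
    exact (not_isScattered_sup_span_iff hL hLnc hx).2 hS ((hscat hx).1 hB)
  rw [hsplit, Set.ncard_union_eq hdisj, Nat.cast_add, hgood, hbad, hL, Set.ncard_univ,
    Nat.card_unique, ← hqdef] at htotal
  have hv : 2 ≤ v := by
    simpa [hL] using Submodule.finrank_le L
  obtain ⟨w, rfl⟩ := Nat.exists_eq_add_of_le hv
  obtain ⟨k, rfl⟩ := Nat.exists_eq_add_of_le (show 1 ≤ g by omega)
  rw [Nat.add_sub_cancel_left, Nat.add_sub_cancel_left]
  have hw := sub_one_mul_gaussBinom_one hq w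
  have h2 := sub_one_mul_gaussBinom_one hq 2
  have hk := sub_one_mul_gaussBinom_one hq k
  have hq0 : (q : ℤ) ≠ 0 := by positivity
  have hq1 : (q : ℤ) - 1 ≠ 0 := by
    have : (1 : ℤ) < q := by exact_mod_cast hq
    omega
  have hT2 : (T.ncard : ℤ) = gaussBinom q 2 1 :=
    mul_left_cancel₀ hq1 (by rw [h2, hmeet, mul_comm])
  apply mul_left_cancel₀ (mul_ne_zero (pow_ne_zero 2 hq0) hq1)
  rw [hT2] at htotal
  linear_combination htotal - (q : ℤ) ^ 2 * hw + (q : ℤ) ^ 2 * gaussBinom q 2 1 * hk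
end

section
/- Let q be a prime power, let v = 2s with s ≥ 2, identify V = GF(q)^v with GF(q^2)^s, and let 𝒢 be the Desarguesian 1-spread of V consisting of the 1-dimensional GF(q^2)-subspaces of GF(q^2)^s regarded as 2-dimensional GF(q)-subspaces. Let L be a 2-dimensional GF(q)-subspace of V not contained in any element of 𝒢. Then the number of 4-dimensional GF(q)-subspaces B of V with L ≤ B such that B is scattered with respect to 𝒢 equals [v-2 choose 2]_q − 1 − q·[2 choose 1]_q·[v-4 choose 1]_q − [v choose 1]_q/[2 choose 1]_q + [4 choose 1]_q/[2 choose 1]_q. -/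
theorem gaussBinom_one_mul (q n : ℕ) (hq : 1 < q) :
    (gaussBinom q n 1 : ℤ) * (q - 1) = (q : ℤ) ^ n - 1 := by
  have hd : q - 1 ∣ q ^ n - 1 := by simpa using Nat.sub_dvd_pow_sub_pow q 1 n
  have h : gaussBinom q n 1 * (q - 1) = q ^ n - 1 := by
    simpa [gaussBinom] using Nat.div_mul_cancel hd
  have := congrArg (Nat.cast : ℕ → ℤ) h
  rwa [Nat.cast_mul, Nat.cast_sub hq.le, Nat.cast_sub (Nat.one_le_pow _ _ (by omega)),
    Nat.cast_pow, Nat.cast_one] at this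

theorem gaussBinom_two_mul (q t : ℕ) (hq : 1 < q) :
    (gaussBinom q (2 * t + 2) 2 : ℤ) * ((q ^ 2 - 1) * (q - 1)) =
      ((q : ℤ) ^ (2 * t + 2) - 1) * ((q : ℤ) ^ (2 * t + 1) - 1) := by
  have hd₁ : q ^ 2 - 1 ∣ q ^ (2 * t + 2) - 1 := by
    rw [show 2 * t + 2 = 2 * (t + 1) by ring, pow_mul]
    simpa only [one_pow] using Nat.sub_dvd_pow_sub_pow (q ^ 2) 1 (t + 1)
  have hd₂ : q - 1 ∣ q ^ (2 * t + 1) - 1 := by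
    simpa using Nat.sub_dvd_pow_sub_pow q 1 (2 * t + 1)
  have h : gaussBinom q (2 * t + 2) 2 * ((q ^ 2 - 1) * (q - 1)) =
      (q ^ (2 * t + 2) - 1) * (q ^ (2 * t + 1) - 1) := by
    simpa [gaussBinom, Finset.prod_range_succ] using Nat.div_mul_cancel (mul_dvd_mul hd₁ hd₂)
  have := congrArg (Nat.cast : ℕ → ℤ) h
  simp only [Nat.cast_mul] at this
  rwa [Nat.cast_sub hq.le, Nat.cast_sub (Nat.one_le_pow _ _ (by omega)),
    Nat.cast_sub (Nat.one_le_pow _ _ (by omega)), Nat.cast_sub (Nat.one_le_pow _ _ (by omega)),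
    Nat.cast_pow, Nat.cast_pow, Nat.cast_pow, Nat.cast_one] at this

theorem gaussBinom_one_div_mul (q t : ℕ) (hq : 1 < q) :
    ((gaussBinom q (2 * t) 1 / gaussBinom q 2 1 : ℕ) : ℤ) * ((q : ℤ) ^ 2 - 1) =
      (q : ℤ) ^ (2 * t) - 1 := by
  have h2 := gaussBinom_one_mul q 2 hq
  have hn := gaussBinom_one_mul q (2 * t) hq
  have hq1 : (q : ℤ) - 1 ≠ 0 := by
    have : (1 : ℤ) < q := by exact_mod_cast hq
    omega
  have hdvd : gaussBinom q 2 1 ∣ gaussBinom q (2 * t) 1 := by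
    rw [← Int.natCast_dvd_natCast, ← mul_dvd_mul_iff_right hq1, h2, hn]
    rw [pow_mul]
    simpa only [one_pow] using sub_dvd_pow_sub_pow ((q : ℤ) ^ 2) 1 t
  obtain ⟨c, hc⟩ := hdvd
  have hpos : 0 < gaussBinom q 2 1 := by
    rcases Nat.eq_zero_or_pos (gaussBinom q 2 1) with h0 | h0
    · rw [h0, Nat.cast_zero, zero_mul] at h2
      have : (1 : ℤ) < q := by exact_mod_cast hq
      nlinarith
    · exact h0
  rw [hc, Nat.mul_div_cancel_left _ hpos, ← h2, ← hn, hc]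
  push_cast
  ring

theorem gaussBinom_expression_eq (q t : ℕ) (hq : 1 < q) (N : ℤ)
    (hN : N * (((q : ℤ) ^ 4 - q ^ 2) * (q ^ 4 - q ^ 3)) =
      (q ^ (2 * t + 4) - q ^ 4) * (q ^ (2 * t + 4) - q ^ 6)) :
    N = (gaussBinom q (2 * t + 2) 2 : ℤ) - 1 -
        (q : ℤ) * (gaussBinom q 2 1 : ℤ) * (gaussBinom q (2 * t) 1 : ℤ) -
        ((gaussBinom q (2 * t + 4) 1 / gaussBinom q 2 1 : ℕ) : ℤ) +
        ((gaussBinom q 4 1 / gaussBinom q 2 1 : ℕ) : ℤ) := by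
  have h₁ := gaussBinom_two_mul q t hq
  have h₂ := gaussBinom_one_mul q 2 hq
  have h₃ := gaussBinom_one_mul q (2 * t) hq
  have h₄ := gaussBinom_one_div_mul q (t + 2) hq
  have h₅ := gaussBinom_one_div_mul q 2 hq
  rw [show 2 * (t + 2) = 2 * t + 4 by ring] at h₄
  norm_num only at h₅
  generalize ((gaussBinom q (2 * t + 4) 1 / gaussBinom q 2 1 : ℕ) : ℤ) = a at *
  generalize ((gaussBinom q 4 1 / gaussBinom q 2 1 : ℕ) : ℤ) = b at *
  generalize (gaussBinom q (2 * t + 2) 2 : ℤ) = c at *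
  generalize (gaussBinom q (2 * t) 1 : ℤ) = d at *
  generalize (gaussBinom q 2 1 : ℤ) = f at *
  have hq' : (1 : ℤ) < q := by exact_mod_cast hq
  generalize (q : ℤ) = r at *
  have hr1 : r - 1 ≠ 0 := by omega
  have hr2 : r + 1 ≠ 0 := by omega
  have hr0 : r ≠ 0 := by omega
  have hf : f = r + 1 := mul_right_cancel₀ hr1 (by linear_combination h₂)
  subst hf
  have hne : r ^ 5 * ((r ^ 2 - 1) * (r - 1)) ≠ 0 := by
    have : r ^ 2 - 1 ≠ 0 := by
      rw [show r ^ 2 - 1 = (r - 1) * (r + 1) by ring]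
      exact mul_ne_zero hr1 hr2
    positivity
  apply mul_right_cancel₀ hne
  simp only [pow_add, pow_mul'] at *
  generalize r ^ t = X at *
  linear_combination hN - r ^ 5 * h₁ + r ^ 6 * (r + 1) * (r ^ 2 - 1) * h₃ +
    r ^ 5 * (r - 1) * h₄ - r ^ 5 * (r - 1) * h₅

section Counting

variable {K V : Type*} [Field K] [AddCommGroup V] [Module K V] [Finite V]

theorem card_mem_sdiff_of_le {U B : Submodule K V} (h : U ≤ B) :
    (Nat.card {x : V // x ∈ B ∧ x ∉ U} : ℤ) = Nat.card B - Nat.card U := by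
  have h1 : {x : V | x ∈ B ∧ x ∉ U} = (B : Set V) \ U := rfl
  have h2 := Set.ncard_sdiff_add_ncard_of_subset (s := (U : Set V)) (t := (B : Set V)) h
  rw [← h1] at h2
  have h3 : Nat.card {x : V // x ∈ B ∧ x ∉ U} + Nat.card U = Nat.card B := h2
  omega

/-- The pairs in `B` that extend `U` by two dimensions. -/
theorem card_pairs_of_le [Finite K] {U B : Submodule K V} (h : U ≤ B) :
    (Nat.card {p : V × V // (p.1 ∈ B ∧ p.1 ∉ U) ∧ (p.2 ∈ B ∧ p.2 ∉ U ⊔ K ∙ p.1)} : ℤ) =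
      (Nat.card B - Nat.card U) * (Nat.card B - Nat.card U * Nat.card K) := by
  classical
  have := Fintype.ofFinite V
  have := Module.finite_of_finite K (M := V)
  let e : {p : V × V // (p.1 ∈ B ∧ p.1 ∉ U) ∧ (p.2 ∈ B ∧ p.2 ∉ U ⊔ K ∙ p.1)} ≃
      Σ x : {x : V // x ∈ B ∧ x ∉ U}, {y : V // y ∈ B ∧ y ∉ U ⊔ K ∙ (x : V)} :=
    { toFun := fun p => ⟨⟨p.1.1, p.2.1⟩, ⟨p.1.2, p.2.2⟩⟩
      invFun := fun p => ⟨(p.1.1, p.2.1), p.1.2, p.2.2⟩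
      left_inv := fun _ => rfl
      right_inv := fun _ => rfl }
  rw [Nat.card_congr e, Nat.card_sigma, Nat.cast_sum, ← card_mem_sdiff_of_le h,
    Finset.sum_congr rfl (g := fun _ => (Nat.card B - Nat.card U * Nat.card K : ℤ))]
  · simp [mul_sub]
  · rintro ⟨x, hxB, hxU⟩ -
    rw [card_mem_sdiff_of_le (sup_le h ((Submodule.span_singleton_le_iff_mem _ _).2 hxB)),
      Module.natCard_eq_pow_finrank (K := K) (V := ↥(U ⊔ K ∙ x)),
      Submodule.finrank_sup_span_singleton hxU, pow_succ,
      ← Module.natCard_eq_pow_finrank (K := K) (V := U), Nat.cast_mul]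

end Counting

section Quadratic

variable {F E V : Type*} [Field F] [Field E] [Algebra F E] [AddCommGroup V] [Module F V]
  [Module E V] [IsScalarTower F E V]

theorem exists_quadratic_generator (h : Module.finrank F E = 2) :
    ∃ e : E, (∀ c : E, ∃ a b : F, c = algebraMap F E a + algebraMap F E b * e) ∧
      ∀ a b : F, algebraMap F E b * e = algebraMap F E a → b = 0 := by
  have : FiniteDimensional F E := Module.finite_of_finrank_pos (by omega)
  have hone : Module.finrank F (F ∙ (1 : E)) = 1 := finrank_span_singleton one_ne_zero
  obtain ⟨e, he⟩ : ∃ e : E, e ∉ F ∙ (1 : E) := by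
    by_contra! hall
    have htop : F ∙ (1 : E) = ⊤ := eq_top_iff.2 fun x _ => hall x
    rw [htop, finrank_top] at hone
    omega
  refine ⟨e, fun c => ?_, fun a b hab => ?_⟩
  · have htop : (F ∙ (1 : E)) ⊔ F ∙ e = ⊤ := by
      apply Submodule.eq_top_of_finrank_eq
      rw [Submodule.finrank_sup_span_singleton he, hone, h]
    have hc : c ∈ (F ∙ (1 : E)) ⊔ F ∙ e := htop ▸ Submodule.mem_top
    obtain ⟨x, hx, y, hy, rfl⟩ := Submodule.mem_sup.1 hc
    obtain ⟨a, rfl⟩ := Submodule.mem_span_singleton.1 hx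
    obtain ⟨b, rfl⟩ := Submodule.mem_span_singleton.1 hy
    exact ⟨a, b, by simp [Algebra.smul_def]⟩
  · by_contra hb
    refine he (Submodule.mem_span_singleton.2 ⟨b⁻¹ * a, ?_⟩)
    have hb' : algebraMap F E b ≠ 0 := by simpa using hb
    rw [Algebra.smul_def, mul_one, map_mul, ← hab, map_inv₀, inv_mul_cancel_left₀ hb']

/-- A subspace contains no line over the quadratic extension generated by `e`. -/
def IsSkew (e : E) (B : Submodule F V) : Prop :=
  ∀ z ∈ B, e • z ∈ B → z = 0

theorem span_singleton_le_of_smul_mem {e : E}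
    (he : ∀ c : E, ∃ a b : F, c = algebraMap F E a + algebraMap F E b * e)
    {B : Submodule F V} {z : V} (hz : z ∈ B) (hez : e • z ∈ B) :
    (E ∙ z).restrictScalars F ≤ B := by
  intro x hx
  obtain ⟨c, rfl⟩ := Submodule.mem_span_singleton.1 hx
  obtain ⟨a, b, rfl⟩ := he c
  rw [add_smul, mul_smul, algebraMap_smul, algebraMap_smul]
  exact B.add_mem (B.smul_mem _ hz) (B.smul_mem _ hez)

theorem exists_add_smul_of_mem_span {e : E}
    (he : ∀ c : E, ∃ a b : F, c = algebraMap F E a + algebraMap F E b * e)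
    (L : Submodule F V) {w : V} (hw : w ∈ Submodule.span E (L : Set V)) :
    ∃ l ∈ L, ∃ l' ∈ L, w = l + e • l' := by
  induction hw using Submodule.span_induction with
  | mem x hx => exact ⟨x, hx, 0, L.zero_mem, by simp⟩
  | zero => exact ⟨0, L.zero_mem, 0, L.zero_mem, by simp⟩
  | add x y _ _ hx hy =>
    obtain ⟨l, hl, l', hl', rfl⟩ := hx
    obtain ⟨m, hm, m', hm', rfl⟩ := hy
    exact ⟨l + m, L.add_mem hl hm, l' + m', L.add_mem hl' hm', by module⟩
  | smul c x _ hx =>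
    obtain ⟨l, hl, l', hl', rfl⟩ := hx
    obtain ⟨a, b, hc⟩ := he c
    obtain ⟨a', b', hc'⟩ := he (c * e)
    refine ⟨a • l + a' • l', L.add_mem (L.smul_mem _ hl) (L.smul_mem _ hl'),
      b • l + b' • l', L.add_mem (L.smul_mem _ hl) (L.smul_mem _ hl'), ?_⟩
    simp only [← algebraMap_smul E a, ← algebraMap_smul E b, ← algebraMap_smul E a',
      ← algebraMap_smul E b']
    rw [smul_add, smul_smul, hc', hc]
    module

theorem natCard_span_eq_sq [Finite V] {e : E}
    (he : ∀ c : E, ∃ a b : F, c = algebraMap F E a + algebraMap F E b * e)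
    {L : Submodule F V} (hL : IsSkew e L) :
    Nat.card (Submodule.span E (L : Set V)) = Nat.card L * Nat.card L := by
  rw [← Nat.card_prod]
  refine (Nat.card_congr (Equiv.ofBijective (fun p : L × L =>
    (⟨p.1 + e • (p.2 : V), add_mem (Submodule.subset_span p.1.2)
      (Submodule.smul_mem _ _ (Submodule.subset_span p.2.2))⟩ :
      Submodule.span E (L : Set V))) ⟨?_, ?_⟩)).symm
  · rintro ⟨⟨a, ha⟩, ⟨b, hb⟩⟩ ⟨⟨c, hc⟩, ⟨d, hd⟩⟩ h
    have h' : a + e • b = c + e • d := congrArg Subtype.val h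
    have hbd : b - d = 0 := hL _ (L.sub_mem hb hd) (by
      rw [show e • (b - d) = c - a by rw [smul_sub]; linear_combination (norm := module) h']
      exact L.sub_mem hc ha)
    obtain rfl := sub_eq_zero.1 hbd
    obtain rfl := add_right_cancel h'
    rfl
  · rintro ⟨w, hw⟩
    obtain ⟨l, hl, l', hl', rfl⟩ := exists_add_smul_of_mem_span he L hw
    exact ⟨(⟨l, hl⟩, ⟨l', hl'⟩), rfl⟩

theorem notMem_span_of_isSkew {e : E}
    (he : ∀ c : E, ∃ a b : F, c = algebraMap F E a + algebraMap F E b * e)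
    {L B : Submodule F V} (hLB : L ≤ B) (hB : IsSkew e B) {x : V} (hx : x ∈ B) (hxL : x ∉ L) :
    x ∉ Submodule.span E (L : Set V) := by
  intro hxW
  obtain ⟨l, hl, l', hl', rfl⟩ := exists_add_smul_of_mem_span he L hxW
  have h := hB l' (hLB hl') ((B.add_mem_iff_right (hLB hl)).1 hx)
  subst h
  exact hxL (by simpa using hl)

theorem notMem_span_sup_of_isSkew {e : E}
    (he : ∀ c : E, ∃ a b : F, c = algebraMap F E a + algebraMap F E b * e)
    {L B : Submodule F V} (hLB : L ≤ B) (hB : IsSkew e B) {x y : V} (hx : x ∈ B) (hxL : x ∉ L)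
    (hy : y ∈ B) (hyL : y ∉ L ⊔ F ∙ x) :
    y ∉ Submodule.span E (L : Set V) ⊔ E ∙ x := by
  intro hyW
  obtain ⟨w, hw, u, hu, rfl⟩ := Submodule.mem_sup.1 hyW
  obtain ⟨c, rfl⟩ := Submodule.mem_span_singleton.1 hu
  obtain ⟨l, hl, l', hl', rfl⟩ := exists_add_smul_of_mem_span he L hw
  obtain ⟨a, b, rfl⟩ := he c
  have hz : l' + b • x ∈ B := B.add_mem (hLB hl') (B.smul_mem _ hx)
  have hez : e • (l' + b • x) ∈ B := by
    have h1 := B.sub_mem hy (B.add_mem (hLB hl) (B.smul_mem a hx))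
    convert h1 using 1
    simp only [← algebraMap_smul E a, ← algebraMap_smul E b]
    module
  have h0 := hB _ hz hez
  have hb : b = 0 := by
    by_contra hb
    refine hxL ?_
    have : x = b⁻¹ • -l' := by
      rw [← eq_neg_of_add_eq_zero_right h0, inv_smul_smul₀ hb]
    rw [this]
    exact L.smul_mem _ (L.neg_mem hl')
  subst hb
  have hl0 : l' = 0 := by simpa using h0
  subst hl0
  apply hyL
  simp only [smul_zero, add_zero, map_zero, zero_mul, algebraMap_smul]
  exact Submodule.add_mem_sup hl (Submodule.smul_mem _ _ (Submodule.mem_span_singleton_self x))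

theorem mem_span_sup_of_mem_sup {L : Submodule F V} {x m : V} (hm : m ∈ L ⊔ F ∙ x) :
    m ∈ Submodule.span E (L : Set V) ⊔ E ∙ x := by
  obtain ⟨l, hl, u, hu, rfl⟩ := Submodule.mem_sup.1 hm
  exact Submodule.add_mem_sup (Submodule.subset_span hl)
    (Submodule.span_le_restrictScalars F E _ hu)

theorem isSkew_sup_sup {e : E} (hne : ∀ a b : F, algebraMap F E b * e = algebraMap F E a → b = 0)
    {L : Submodule F V} (hL : IsSkew e L) {x y : V} (hx : x ∉ Submodule.span E (L : Set V))
    (hy : y ∉ Submodule.span E (L : Set V) ⊔ E ∙ x) :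
    IsSkew e (L ⊔ F ∙ x ⊔ F ∙ y) := by
  have key : ∀ (W : Submodule E V) (u w w' : V) (b b' : F), u ∉ W → w ∈ W → w' ∈ W →
      e • (w + b • u) = w' + b' • u → b = 0 ∧ b' = 0 := by
    intro W u w w' b b' hu hw hw' h
    have hc : algebraMap F E b * e - algebraMap F E b' = 0 := by
      by_contra hc
      refine hu ((W.smul_mem_iff hc).1 ?_)
      have : (algebraMap F E b * e - algebraMap F E b') • u = w' - e • w := by
        simp only [← algebraMap_smul E b, ← algebraMap_smul E b'] at h
        linear_combination (norm := module) h
      rw [this]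
      exact W.sub_mem hw' (W.smul_mem _ hw)
    have hb := hne _ _ (sub_eq_zero.1 hc)
    subst hb
    simpa using hc
  intro z hz hez
  obtain ⟨m, hm, u, hu, rfl⟩ := Submodule.mem_sup.1 hz
  obtain ⟨b, rfl⟩ := Submodule.mem_span_singleton.1 hu
  obtain ⟨m', hm', u', hu', h⟩ := Submodule.mem_sup.1 hez
  obtain ⟨b', rfl⟩ := Submodule.mem_span_singleton.1 hu'
  obtain ⟨rfl, rfl⟩ := key _ y m m' b b' hy (mem_span_sup_of_mem_sup hm)
    (mem_span_sup_of_mem_sup hm') h.symm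
  obtain ⟨l, hl, u, hu, rfl⟩ := Submodule.mem_sup.1 hm
  obtain ⟨a, rfl⟩ := Submodule.mem_span_singleton.1 hu
  obtain ⟨l', hl', u', hu', rfl⟩ := Submodule.mem_sup.1 hm'
  obtain ⟨a', rfl⟩ := Submodule.mem_span_singleton.1 hu'
  simp only [zero_smul, add_zero] at h ⊢
  obtain ⟨rfl, rfl⟩ := key _ x l l' a a' hx (Submodule.subset_span hl)
    (Submodule.subset_span hl') h.symm
  simp only [zero_smul, add_zero] at h ⊢
  exact hL l hl (h ▸ hl')

/-- Double counting of the skew subspaces two dimensions above a skew subspace `L`. -/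
theorem ncard_isSkew_mul [Finite F] [Finite E] [Finite V] {e : E}
    (he : ∀ c : E, ∃ a b : F, c = algebraMap F E a + algebraMap F E b * e)
    (hne : ∀ a b : F, algebraMap F E b * e = algebraMap F E a → b = 0)
    {L : Submodule F V} (hL : IsSkew e L) :
    ({B : Submodule F V | Module.finrank F B = Module.finrank F L + 2 ∧ L ≤ B ∧
        IsSkew e B}.ncard : ℤ) *
      (((Nat.card F : ℤ) ^ (Module.finrank F L + 2) - (Nat.card F : ℤ) ^ Module.finrank F L) *
        ((Nat.card F : ℤ) ^ (Module.finrank F L + 2) -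
          (Nat.card F : ℤ) ^ Module.finrank F L * Nat.card F)) =
      (Nat.card V - Nat.card (Submodule.span E (L : Set V))) *
        (Nat.card V - Nat.card (Submodule.span E (L : Set V)) * Nat.card E) := by
  classical
  have := Module.finite_of_finite F (M := V)
  set W := Submodule.span E (L : Set V)
  set G := {B : Submodule F V | Module.finrank F B = Module.finrank F L + 2 ∧ L ≤ B ∧ IsSkew e B}
  have hrank : ∀ x y, x ∉ L → y ∉ L ⊔ F ∙ x →
      Module.finrank F ↥(L ⊔ F ∙ x ⊔ F ∙ y) = Module.finrank F L + 2 := by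
    intro x y hx hy
    rw [Submodule.finrank_sup_span_singleton hy, Submodule.finrank_sup_span_singleton hx]
  let f : (Σ B : G, {p : V × V // (p.1 ∈ B.1 ∧ p.1 ∉ L) ∧ (p.2 ∈ B.1 ∧ p.2 ∉ L ⊔ F ∙ p.1)}) →
      {p : V × V // (p.1 ∈ (⊤ : Submodule E V) ∧ p.1 ∉ W) ∧
        (p.2 ∈ (⊤ : Submodule E V) ∧ p.2 ∉ W ⊔ E ∙ p.1)} :=
    fun t => ⟨t.2.1, ⟨trivial, notMem_span_of_isSkew he t.1.2.2.1 t.1.2.2.2 t.2.2.1.1 t.2.2.1.2⟩,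
      trivial, notMem_span_sup_of_isSkew he t.1.2.2.1 t.1.2.2.2 t.2.2.1.1 t.2.2.1.2
        t.2.2.2.1 t.2.2.2.2⟩
  have hf : Function.Bijective f := by
    constructor
    · have hB : ∀ (B : G) (p : V × V), (p.1 ∈ B.1 ∧ p.1 ∉ L) ∧ (p.2 ∈ B.1 ∧ p.2 ∉ L ⊔ F ∙ p.1) →
          L ⊔ F ∙ p.1 ⊔ F ∙ p.2 = B.1 := by
        rintro ⟨B, hB4, hLB, _⟩ p ⟨⟨h1, h2⟩, h3, h4⟩
        refine Submodule.eq_of_le_of_finrank_eq ?_ ((hrank _ _ h2 h4).trans hB4.symm)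
        exact sup_le (sup_le hLB ((Submodule.span_singleton_le_iff_mem _ _).2 h1))
          ((Submodule.span_singleton_le_iff_mem _ _).2 h3)
      rintro ⟨B, p, hp⟩ ⟨B', p', hp'⟩ h
      obtain rfl : p = p' := congrArg Subtype.val h
      obtain rfl : B = B' := Subtype.ext ((hB B p hp).symm.trans (hB B' p hp'))
      rfl
    · rintro ⟨⟨x, y⟩, ⟨-, hx⟩, -, hy⟩
      have hxL : x ∉ L := fun h => hx (Submodule.subset_span h)
      have hyL : y ∉ L ⊔ F ∙ x := fun h => hy (mem_span_sup_of_mem_sup h)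
      exact ⟨⟨⟨L ⊔ F ∙ x ⊔ F ∙ y, hrank x y hxL hyL, le_sup_left.trans le_sup_left,
        isSkew_sup_sup hne hL hx hy⟩, ⟨(x, y),
          ⟨Submodule.mem_sup_left (Submodule.mem_sup_right (Submodule.mem_span_singleton_self x)),
            hxL⟩,
          Submodule.mem_sup_right (Submodule.mem_span_singleton_self y), hyL⟩⟩, rfl⟩
  have hcard := Nat.card_congr (Equiv.ofBijective f hf)
  have : Fintype G := Fintype.ofFinite G
  rw [Nat.card_sigma] at hcard
  have hcard' := congrArg (Nat.cast : ℕ → ℤ) hcard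
  rw [card_pairs_of_le le_top, Nat.cast_sum, Finset.sum_congr rfl (g := fun _ =>
      (((Nat.card F : ℤ) ^ (Module.finrank F L + 2) - (Nat.card F : ℤ) ^ Module.finrank F L) *
        ((Nat.card F : ℤ) ^ (Module.finrank F L + 2) -
          (Nat.card F : ℤ) ^ Module.finrank F L * Nat.card F)))] at hcard'
  · rw [Finset.sum_const, nsmul_eq_mul, Finset.card_univ, ← Nat.card_eq_fintype_card,
      Nat.card_coe_set_eq, Nat.card_congr (Equiv.subtypeUnivEquiv (p := (· ∈ (⊤ : Submodule E V)))
        fun _ => trivial)] at hcard'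
    exact hcard'
  · rintro ⟨B, hB4, hLB, -⟩ -
    rw [card_pairs_of_le hLB, Module.natCard_eq_pow_finrank (K := F) (V := B),
      Module.natCard_eq_pow_finrank (K := F) (V := L), hB4]
    push_cast
    rfl

end Quadratic

theorem finrank_eq_of_mem_desargSpread {F E : Type*} [Field F] [Field E] [Algebra F E] {s : ℕ}
    {S : Submodule F (Fin s → E)} (hS : S ∈ DesargSpread F E s) :
    Module.finrank F S = Module.finrank F E := by
  obtain ⟨W, hW, rfl⟩ := hS
  have := Module.finrank_mul_finrank F E W
  rw [hW, mul_one] at this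
  exact this.symm

theorem isScattered_desargSpread_iff {F E : Type*} [Field F] [Field E] [Algebra F E] {s : ℕ}
    (hFE : Module.finrank F E = 2) {e : E}
    (he : ∀ c : E, ∃ a b : F, c = algebraMap F E a + algebraMap F E b * e)
    (B : Submodule F (Fin s → E)) :
    IsScattered F (DesargSpread F E s) B ↔ IsSkew e B := by
  have : FiniteDimensional F E := Module.finite_of_finrank_pos (by omega)
  constructor
  · intro h z hz hez
    by_contra hz0
    have hmem : (E ∙ z).restrictScalars F ∈ DesargSpread F E s :=
      ⟨E ∙ z, finrank_span_singleton hz0, rfl⟩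
    have h1 := h _ hmem
    rw [inf_eq_right.2 (span_singleton_le_of_smul_mem he hz hez),
      finrank_eq_of_mem_desargSpread hmem] at h1
    omega
  · intro h S hS
    by_contra! hlt
    have hSB : B ⊓ S = S := Submodule.eq_of_le_of_finrank_le inf_le_right
      (by rw [finrank_eq_of_mem_desargSpread hS]; omega)
    obtain ⟨W, hW, rfl⟩ := hS
    have hWB : W.restrictScalars F ≤ B := inf_eq_right.1 hSB
    obtain ⟨z, hz, hz0⟩ := W.exists_mem_ne_zero_of_ne_bot (by
      rintro rfl
      simp at hW)
    exact hz0 (h z (hWB hz) (hWB (W.smul_mem e hz)))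

theorem stmt_1 (F E : Type) [Field F] [Fintype F] [Field E] [Fintype E] [Algebra F E]
    (hFE : Module.finrank F E = 2) (s v : ℕ) (hs : 2 ≤ s) (hv : v = 2 * s)
    (L : Submodule F (Fin s → E)) (hL : Module.finrank F L = 2)
    (hLnc : ¬ ∃ S ∈ DesargSpread F E s, L ≤ S) :
    ({B : Submodule F (Fin s → E) | Module.finrank F B = 4 ∧ L ≤ B ∧
        IsScattered F (DesargSpread F E s) B}.ncard : ℤ) =
      (gaussBinom (Fintype.card F) (v - 2) 2 : ℤ) - 1 -
        (Fintype.card F : ℤ) * (gaussBinom (Fintype.card F) 2 1 : ℤ) *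
          (gaussBinom (Fintype.card F) (v - 4) 1 : ℤ) -
        ((gaussBinom (Fintype.card F) v 1 / gaussBinom (Fintype.card F) 2 1 : ℕ) : ℤ) +
        ((gaussBinom (Fintype.card F) 4 1 / gaussBinom (Fintype.card F) 2 1 : ℕ) : ℤ) := by
  obtain ⟨e, he, hne⟩ := exists_quadratic_generator hFE
  obtain ⟨t, rfl⟩ : ∃ t, s = t + 2 := ⟨s - 2, by omega⟩
  have hLskew : IsSkew e L := by
    intro z hz hez
    by_contra hz0
    have hmem : (E ∙ z).restrictScalars F ∈ DesargSpread F E (t + 2) :=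
      ⟨E ∙ z, finrank_span_singleton hz0, rfl⟩
    refine hLnc ⟨_, hmem, (Submodule.eq_of_le_of_finrank_eq
      (span_singleton_le_of_smul_mem he hz hez) ?_).ge⟩
    rw [finrank_eq_of_mem_desargSpread hmem, hFE, hL]
  have hcount := ncard_isSkew_mul he hne hLskew
  have hcardE : Nat.card E = Fintype.card F ^ 2 := by
    rw [Module.natCard_eq_pow_finrank (K := F), hFE, Nat.card_eq_fintype_card]
  have hcardL : Nat.card L = Fintype.card F ^ 2 := by
    rw [Module.natCard_eq_pow_finrank (K := F), hL, Nat.card_eq_fintype_card]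
  have hcardV : Nat.card (Fin (t + 2) → E) = Fintype.card F ^ (2 * t + 4) := by
    rw [Nat.card_fun, hcardE, Nat.card_fin, ← pow_mul]
    congr 1
  rw [natCard_span_eq_sq he hLskew, hcardE, hcardL, hcardV, hL, Nat.card_eq_fintype_card] at hcount
  rw [hv, show 2 * (t + 2) - 2 = 2 * t + 2 by omega, show 2 * (t + 2) - 4 = 2 * t by omega,
    show 2 * (t + 2) = 2 * t + 4 by omega]
  simp only [isScattered_desargSpread_iff hFE he]
  refine gaussBinom_expression_eq _ t Fintype.one_lt_card _ ?_
  push_cast at hcount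
  linear_combination hcount
end

section
/- Let q be a prime power and let (V, 𝒢, ℬ) be a (v, g, k, λ)_q-GDD with 2 ≤ g ≤ k. Then q^{k-g} divides λ. -/
section LinearForms

variable {F V : Type*} [Field F] [AddCommGroup V] [Module F V]

/-- A vector killed by a linear form and one that is not span a two-dimensional subspace. -/
theorem finrank_span_pair_of_apply_eq_zero {f : V →ₗ[F] F} {p x : V} (hp : p ≠ 0)
    (hfp : f p = 0) (hfx : f x ≠ 0) : Module.finrank F (Submodule.span F {p, x}) = 2 := by
  have hli : LinearIndependent F ![p, x] := by
    rw [LinearIndependent.pair_iff' hp]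
    rintro a rfl
    exact hfx (by simp [hfp])
  rw [← Matrix.range_cons_cons_empty p x ![], finrank_span_eq_card hli, Fintype.card_fin]

/-- A subspace of dimension at least two contains a nonzero vector in the kernel of some linear
form that does not vanish on the subspace. -/
theorem exists_dual_apply_eq_zero_of_two_le_finrank {S : Submodule F V}
    (hS : 2 ≤ Module.finrank F S) :
    ∃ p ∈ S, ∃ s ∈ S, ∃ f : V →ₗ[F] F, p ≠ 0 ∧ f p = 0 ∧ f s ≠ 0 := by
  obtain ⟨p, hpS, hp⟩ : ∃ p ∈ S, p ≠ 0 := by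
    apply S.exists_mem_ne_zero_of_ne_bot
    rintro rfl
    simp at hS
  obtain ⟨s, hsS, hs⟩ : ∃ s ∈ S, s ∉ Submodule.span F {p} := by
    by_contra! hle
    have hfin := Submodule.finrank_mono (show S ≤ Submodule.span F {p} from hle)
    rw [finrank_span_singleton hp] at hfin
    omega
  obtain ⟨f, hfs, hf⟩ := Submodule.exists_le_ker_of_notMem hs
  exact ⟨p, hpS, s, hsS, f, hp, hf (Submodule.mem_span_singleton_self p), hfs⟩

/-- The number of vectors of a finite subspace at which a linear form, nonzero on that subspace,
does not vanish. -/
theorem ncard_mem_apply_ne_zero [Fintype F] [Finite V] (W : Submodule F V) (f : V →ₗ[F] F)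
    {w : V} (hw : w ∈ W) (hfw : f w ≠ 0) :
    {x | x ∈ W ∧ f x ≠ 0}.ncard =
      (Fintype.card F - 1) * Fintype.card F ^ (Module.finrank F W - 1) := by
  have hker : Module.finrank F ↥(W ⊓ LinearMap.ker f) + 1 = Module.finrank F W := by
    have hne : f.domRestrict W ≠ 0 := fun h0 => hfw (by simpa using LinearMap.congr_fun h0 ⟨w, hw⟩)
    rw [← Module.Dual.finrank_ker_add_one_of_ne_zero hne,
      ← Submodule.finrank_map_subtype_eq W, LinearMap.ker_domRestrict,
      ← Submodule.map_comap_subtype]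
  have hcard (U : Submodule F V) : (U : Set V).ncard = Fintype.card F ^ Module.finrank F U := by
    rw [← Nat.card_eq_fintype_card, ← Module.natCard_eq_pow_finrank]
    rfl
  have hset : {x | x ∈ W ∧ f x ≠ 0} = (W : Set V) \ (W ⊓ LinearMap.ker f : Submodule F V) := by
    ext x
    simp +contextual [LinearMap.mem_ker]
  rw [hset, Set.ncard_sdiff (SetLike.coe_subset_coe.2 inf_le_left), hcard, hcard, ← hker,
    Nat.add_sub_cancel, pow_succ, Nat.sub_mul, one_mul, mul_comm]

end LinearForms

section GroupDivisibleDesign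

variable {F V : Type*} [Field F] [AddCommGroup V] [Module F V] {g k lam : ℕ}
  {𝒢 ℬ : Set (Submodule F V)}

theorem IsSpread.eq_of_mem (h : IsSpread F g 𝒢) {S T : Submodule F V} (hS : S ∈ 𝒢) (hT : T ∈ 𝒢)
    {p : V} (hp : p ≠ 0) (hpS : p ∈ S) (hpT : p ∈ T) : S = T :=
  (h.2 (Submodule.span F {p}) (finrank_span_singleton hp)).unique
    ⟨hS, by simpa using hpS⟩ ⟨hT, by simpa using hpT⟩

theorem IsGDD.finrank_lt [FiniteDimensional F V] (h : IsGDD F g k lam 𝒢 ℬ) :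
    g < Module.finrank F V := by
  by_contra! hle
  have htop : ∀ S ∈ 𝒢, S = ⊤ := fun S hS =>
    Submodule.eq_top_of_finrank_eq (le_antisymm S.finrank_le (by rwa [h.1.1 S hS]))
  have := Set.ncard_le_ncard (show 𝒢 ⊆ {⊤} from htop)
  rw [Set.ncard_singleton] at this
  exact absurd h.2.1 (by omega)

/-- The number of blocks through a point `p` of a group `S` and a second vector `x` off a
hyperplane containing `p`. -/
theorem IsGDD.ncard_blocks_mem_mem (h : IsGDD F g k lam 𝒢 ℬ) {S : Submodule F V} (hS : S ∈ 𝒢)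
    {f : V →ₗ[F] F} {p x : V} (hp : p ≠ 0) (hpS : p ∈ S) (hfp : f p = 0) (hfx : f x ≠ 0)
    [Decidable (x ∈ S)] :
    {B | (B ∈ ℬ ∧ p ∈ B) ∧ x ∈ B}.ncard = if x ∈ S then 0 else lam := by
  obtain ⟨hin, hout⟩ := h.2.2.2 _ (finrank_span_pair_of_apply_eq_zero hp hfp hfx)
  have hspan (B : Submodule F V) : Submodule.span F {p, x} ≤ B ↔ p ∈ B ∧ x ∈ B := by
    simp [Submodule.span_le, Set.insert_subset_iff]
  simp only [hspan] at hin hout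
  simp only [and_assoc]
  split_ifs with hxS
  · have hempty : {B | B ∈ ℬ ∧ p ∈ B ∧ x ∈ B} = ∅ :=
      Set.eq_empty_iff_forall_notMem.2 fun B hB => (hin ⟨S, hS, hpS, hxS⟩).2 B hB.1 hB.2
    rw [hempty, Set.ncard_empty]
  · refine hout ?_
    rintro ⟨T, hT, hpT, hxT⟩
    exact hxS (h.1.eq_of_mem hS hT hp hpS hpT ▸ hxT)

/-- Double counting of the pairs of a block through a fixed point and a vector of that block off
a hyperplane which contains the point but not its group. -/
theorem IsGDD.dvd_mul_index [Fintype F] [Finite V] (h : IsGDD F g k lam 𝒢 ℬ) (hg : 2 ≤ g) :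
    (Fintype.card F - 1) * Fintype.card F ^ (k - 1) ∣
      ((Fintype.card F - 1) * Fintype.card F ^ (Module.finrank F V - 1) -
        (Fintype.card F - 1) * Fintype.card F ^ (g - 1)) * lam := by
  classical
  obtain ⟨S, hS⟩ : 𝒢.Nonempty := Set.nonempty_of_ncard_ne_zero (by have := h.2.1; omega)
  have hSg := h.1.1 S hS
  obtain ⟨p, hpS, s, hsS, f, hp, hfp, hfs⟩ :=
    exists_dual_apply_eq_zero_of_two_le_finrank (S := S) (by omega)
  have := Fintype.ofFinite V
  have := Fintype.ofFinite (Submodule F V)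
  have hcount := Finset.sum_card_bipartiteAbove_eq_sum_card_bipartiteBelow
    (s := {x : V | f x ≠ 0}) (t := {B : Submodule F V | B ∈ ℬ ∧ p ∈ B}) (fun x B => x ∈ B)
  have habove : ∀ x ∈ ({x : V | f x ≠ 0} : Finset V),
      (Finset.bipartiteAbove (fun (x : V) (B : Submodule F V) => x ∈ B)
        {B : Submodule F V | B ∈ ℬ ∧ p ∈ B} x).card = if x ∉ S then lam else 0 := by
    intro x hx
    rw [ite_not, ← h.ncard_blocks_mem_mem hS hp hpS hfp (Finset.mem_filter.1 hx).2,
      ← Set.ncard_coe_finset]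
    congr 1
    ext B
    simp
  have hoff : ({x ∈ ({x : V | f x ≠ 0} : Finset V) | x ∉ S}).card =
      (Fintype.card F - 1) * Fintype.card F ^ (Module.finrank F V - 1) -
        (Fintype.card F - 1) * Fintype.card F ^ (g - 1) := by
    have hsub : {x | x ∈ S ∧ f x ≠ 0} ⊆ {x | x ∈ (⊤ : Submodule F V) ∧ f x ≠ 0} :=
      fun x hx => ⟨Submodule.mem_top, hx.2⟩
    rw [← hSg, ← ncard_mem_apply_ne_zero S f hsS hfs, ← finrank_top F V,
      ← ncard_mem_apply_ne_zero ⊤ f Submodule.mem_top hfs,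
      ← Set.ncard_sdiff hsub, ← Set.ncard_coe_finset]
    congr 1
    ext x
    simp only [Finset.coe_filter, Finset.mem_filter, Finset.mem_univ, Set.mem_sdiff,
      Set.mem_ofPred_eq, Submodule.mem_top]
    tauto
  rw [Finset.sum_congr rfl habove, ← Finset.sum_filter, Finset.sum_const, hoff,
    smul_eq_mul] at hcount
  rw [hcount]
  refine Finset.dvd_sum fun B hB => ?_
  have hset : ((Finset.bipartiteBelow (fun (x : V) (B : Submodule F V) => x ∈ B)
      {x : V | f x ≠ 0} B : Finset V) : Set V) = {x | x ∈ B ∧ f x ≠ 0} := by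
    ext x
    simp [and_comm]
  rw [← Set.ncard_coe_finset, hset]
  by_cases hBf : ∃ w ∈ B, f w ≠ 0
  · obtain ⟨w, hw, hfw⟩ := hBf
    rw [ncard_mem_apply_ne_zero B f hw hfw, h.2.2.1 B (Finset.mem_filter.1 hB).2.1]
  · have hempty : {x | x ∈ B ∧ f x ≠ 0} = ∅ :=
      Set.eq_empty_iff_forall_notMem.2 fun x hx => hBf ⟨x, hx.1, hx.2⟩
    rw [hempty, Set.ncard_empty]
    exact dvd_zero _

end GroupDivisibleDesign

/-- If `q ^ b (q - 1)` divides `(q - 1) (q ^ n - q ^ a) m` with `a < n` and `a ≤ b`, then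
`q ^ (b - a)` divides `m`. -/
theorem pow_sub_dvd_of_dvd_mul_pow_sub_pow {q a b n m : ℕ} (hq : 1 < q) (hab : a ≤ b) (han : a < n)
    (h : (q - 1) * q ^ b ∣ ((q - 1) * q ^ n - (q - 1) * q ^ a) * m) : q ^ (b - a) ∣ m := by
  obtain ⟨c, rfl⟩ := Nat.exists_eq_add_of_le hab
  obtain ⟨d, rfl⟩ := Nat.exists_eq_add_of_lt han
  have hfactor : ((q - 1) * q ^ (a + d + 1) - (q - 1) * q ^ a) * m =
      ((q - 1) * q ^ a) * ((q ^ (d + 1) - 1) * m) := by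
    rw [add_assoc, pow_add, ← mul_assoc, ← mul_assoc, Nat.mul_sub, mul_one]
  rw [hfactor, pow_add, ← mul_assoc] at h
  have hdvd := Nat.dvd_of_mul_dvd_mul_left
    (Nat.mul_pos (Nat.sub_pos_of_lt hq) (Nat.pow_pos (by omega))) h
  rw [Nat.add_sub_cancel_left]
  refine Nat.Coprime.dvd_of_dvd_mul_left (Nat.Coprime.pow_left c ?_) hdvd
  refine Nat.Coprime.coprime_dvd_left (dvd_pow_self q d.succ_ne_zero) ?_
  exact (Nat.coprime_self_sub_right (Nat.one_le_pow _ _ (by omega))).2 (Nat.coprime_one_right _)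

theorem stmt_4 (F : Type) [Field F] [Fintype F] (v g k lam : ℕ)
    (hg2 : 2 ≤ g) (hgk : g ≤ k) (hk : 0 < k) (hlam : 0 < lam)
    (𝒢 ℬ : Set (Submodule F (Fin v → F))) (h : IsGDD F g k lam 𝒢 ℬ) :
    (Fintype.card F) ^ (k - g) ∣ lam := by
  have hlt := h.finrank_lt
  have hdvd := pow_sub_dvd_of_dvd_mul_pow_sub_pow Fintype.one_lt_card (by omega) (by omega)
    (h.dvd_mul_index hg2)
  rwa [show k - 1 - (g - 1) = k - g by omega] at hdvd
end

section
/- Let q be a prime power and let (V, 𝒢, ℬ) be a (v, g, k, λ)_q-GDD. Then the number of blocks is #ℬ = λ · ([v choose 2]_q − [g choose 2]_q · [v choose 1]_q / [g choose 1]_q) / [k choose 2]_q, where [n choose m]_q denotes the Gaussian binomial coefficient. -/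
/-- The linearly independent `m`-tuples spanning an `m`-dimensional subspace `L` are the linearly
independent `m`-tuples of `L`. -/
def linearIndependentSpanEquiv {F V : Type*} [Field F] [AddCommGroup V] [Module F V] [Finite V]
    {m : ℕ} (L : Submodule F V) (hL : Module.finrank F L = m) :
    {s : {s : Fin m → V // LinearIndependent F s} // Submodule.span F (Set.range s.1) = L} ≃
      {s : Fin m → L // LinearIndependent F s} where
  toFun s := ⟨fun i => ⟨s.1.1 i, s.2.le (Submodule.subset_span ⟨i, rfl⟩)⟩,
    LinearIndependent.of_comp L.subtype s.1.2⟩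
  invFun s := ⟨⟨fun i => (s.1 i : V), s.2.map' L.subtype L.ker_subtype⟩, by
    have : Module.Finite F L := Module.Finite.of_finite
    apply Submodule.eq_of_le_of_finrank_eq
    · rw [Submodule.span_le]
      rintro _ ⟨i, rfl⟩
      exact (s.1 i).2
    · exact (finrank_span_eq_card (s.2.map' L.subtype L.ker_subtype)).trans (by simp [hL])⟩
  left_inv _ := rfl
  right_inv _ := rfl

/-- The linearly independent `m`-tuples of `V`, sorted by the subspace they span. -/
def linearIndependentEquivSigma (F V : Type*) [Field F] [AddCommGroup V]
    [Module F V] [Finite V] (m : ℕ) :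
    {s : Fin m → V // LinearIndependent F s} ≃
      Σ L : {L : Submodule F V // Module.finrank F L = m},
        {s : Fin m → L.1 // LinearIndependent F s} :=
  (Equiv.sigmaFiberEquiv fun s : {s : Fin m → V // LinearIndependent F s} =>
      (⟨Submodule.span F (Set.range s.1), by simpa using finrank_span_eq_card s.2⟩ :
        {L : Submodule F V // Module.finrank F L = m})).symm.trans <|
    Equiv.sigmaCongrRight fun L =>
      (Equiv.subtypeEquivRight fun _ => Subtype.ext_iff).trans
        (linearIndependentSpanEquiv L.1 L.2)

theorem prod_pow_sub_pow (q n m : ℕ) (h : m ≤ n) :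
    ∏ i ∈ Finset.range m, (q ^ n - q ^ i) =
      (∏ i ∈ Finset.range m, q ^ i) * ∏ i ∈ Finset.range m, (q ^ (n - i) - 1) := by
  rw [← Finset.prod_mul_distrib]
  refine Finset.prod_congr rfl fun i hi => ?_
  have := Finset.mem_range.1 hi
  rw [Nat.mul_sub, ← pow_add, mul_one, Nat.add_sub_cancel' (by omega)]

theorem card_submodule_finrank_eq (F V : Type*) [Field F] [Fintype F] [AddCommGroup V]
    [Module F V] [Finite V] (m : ℕ) :
    Nat.card {L : Submodule F V // Module.finrank F L = m} =
      gaussBinom (Fintype.card F) (Module.finrank F V) m := by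
  have hq : 1 < Fintype.card F := Fintype.one_lt_card
  have : Module.Finite F V := Module.Finite.of_finite
  have := Fintype.ofFinite {L : Submodule F V // Module.finrank F L = m}
  unfold gaussBinom
  rcases le_or_gt m (Module.finrank F V) with hm | hm
  · have hc := Nat.card_congr (linearIndependentEquivSigma F V m)
    have hfib : ∀ L : {L : Submodule F V // Module.finrank F L = m},
        Nat.card {s : Fin m → L.1 // LinearIndependent F s} =
          ∏ i ∈ Finset.range m, (Fintype.card F ^ m - Fintype.card F ^ i) := by
      intro L
      rw [card_linearIndependent (K := F) L.2.ge, L.2,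
        Finset.prod_range fun i => Fintype.card F ^ m - Fintype.card F ^ i]
    rw [card_linearIndependent hm, Nat.card_sigma, Finset.sum_congr rfl fun L _ => hfib L,
      Finset.sum_const, smul_eq_mul, Finset.card_univ,
      ← Nat.card_eq_fintype_card (α := {L : Submodule F V // Module.finrank F L = m}),
      ← Finset.prod_range fun i => Fintype.card F ^ Module.finrank F V - Fintype.card F ^ i,
      prod_pow_sub_pow _ _ _ hm, prod_pow_sub_pow _ _ _ le_rfl, mul_left_comm] at hc
    have hpos : 0 < ∏ i ∈ Finset.range m, Fintype.card F ^ i :=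
      Finset.prod_pos fun i _ => pow_pos (by omega) i
    have hden : 0 < ∏ i ∈ Finset.range m, (Fintype.card F ^ (m - i) - 1) := by
      refine Finset.prod_pos fun i hi => ?_
      have := Finset.mem_range.1 hi
      exact Nat.sub_pos_of_lt (Nat.one_lt_pow (by omega) hq)
    exact (Nat.div_eq_of_eq_mul_left hden (Nat.eq_of_mul_eq_mul_left hpos hc)).symm
  · rw [Finset.prod_eq_zero (Finset.mem_range.2 hm) (by simp), Nat.zero_div]
    have : IsEmpty {L : Submodule F V // Module.finrank F L = m} :=
      ⟨fun L => (L.2 ▸ L.1.finrank_le).not_gt hm⟩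
    exact Nat.card_of_isEmpty

theorem ncard_submodule_le_finrank_eq {F V : Type*} [Field F] [Fintype F] [AddCommGroup V]
    [Module F V] [Finite V] (B : Submodule F V) (m : ℕ) :
    {L : Submodule F V | Module.finrank F L = m ∧ L ≤ B}.ncard =
      gaussBinom (Fintype.card F) (Module.finrank F B) m := by
  have himage : {L : Submodule F V | Module.finrank F L = m ∧ L ≤ B} =
      Submodule.map B.subtype '' {L : Submodule F B | Module.finrank F L = m} := by
    ext L
    constructor
    · rintro ⟨hL, hLB⟩
      refine ⟨L.comap B.subtype, ?_, ?_⟩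
      · exact (Submodule.comapSubtypeEquivOfLe hLB).finrank_eq.trans hL
      · rw [Submodule.map_comap_subtype, inf_eq_right.2 hLB]
    · rintro ⟨L, hL, rfl⟩
      exact ⟨(Submodule.finrank_map_subtype_eq B L).trans hL, Submodule.map_subtype_le B L⟩
  rw [himage, Set.ncard_image_of_injective _ (Submodule.map_injective_of_injective
    B.injective_subtype), ← card_submodule_finrank_eq F B m]
  rfl

/-- Double counting of the incident pairs of an `m`-dimensional subspace and a member of `𝒜`. -/
theorem sum_ncard_le_eq {F V : Type*} [Field F] [Fintype F] [AddCommGroup V] [Module F V]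
    [Finite V] {d m : ℕ} {𝒜 : Set (Submodule F V)}
    (h𝒜 : ∀ B ∈ 𝒜, Module.finrank F B = d) {T : Finset (Submodule F V)}
    (hT : ∀ L, L ∈ T ↔ Module.finrank F L = m) :
    ∑ L ∈ T, {B ∈ 𝒜 | L ≤ B}.ncard = 𝒜.ncard * gaussBinom (Fintype.card F) d m := by
  classical
  have := Fintype.ofFinite (Submodule F V)
  have h := Finset.sum_card_bipartiteAbove_eq_sum_card_bipartiteBelow (s := T)
    (t := 𝒜.toFinset) (fun L B => L ≤ B)
  have habove : ∀ L ∈ T, {B ∈ 𝒜 | L ≤ B}.ncard =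
      (𝒜.toFinset.bipartiteAbove (fun L B => L ≤ B) L).card := by
    intro L _
    rw [← Set.ncard_coe_finset]
    congr 1
    ext B
    simp
  have hbelow : ∀ B ∈ 𝒜.toFinset, (T.bipartiteBelow (fun L B => L ≤ B) B).card =
      gaussBinom (Fintype.card F) d m := by
    intro B hB
    rw [← h𝒜 B (Set.mem_toFinset.1 hB), ← ncard_submodule_le_finrank_eq, ← Set.ncard_coe_finset]
    congr 1
    ext L
    simp [hT]
  rw [Finset.sum_congr rfl habove, h, Finset.sum_congr rfl hbelow, Finset.sum_const, smul_eq_mul,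
    Set.ncard_eq_toFinset_card']

theorem card_eq_gaussBinom {F V : Type*} [Field F] [Fintype F] [AddCommGroup V] [Module F V]
    [Finite V] {m : ℕ} {T : Finset (Submodule F V)}
    (hT : ∀ L, L ∈ T ↔ Module.finrank F L = m) :
    T.card = gaussBinom (Fintype.card F) (Module.finrank F V) m := by
  rw [← card_submodule_finrank_eq F V m, Nat.card_congr (Equiv.subtypeEquivRight fun L => (hT L).symm),
    Nat.card_eq_fintype_card, Fintype.card_coe]

theorem gaussBinom_pos_of_le {F V : Type*} [Field F] [Fintype F] [AddCommGroup V] [Module F V]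
    [Finite V] {L B : Submodule F V} (h : L ≤ B) :
    0 < gaussBinom (Fintype.card F) (Module.finrank F B) (Module.finrank F L) := by
  rw [← ncard_submodule_le_finrank_eq]
  exact (Set.ncard_pos (Set.toFinite _)).2 ⟨L, rfl, h⟩

theorem exists_finrank_eq_one_le {F V : Type*} [Field F] [AddCommGroup V] [Module F V]
    {S : Submodule F V} (hS : 0 < Module.finrank F S) :
    ∃ P ≤ S, Module.finrank F P = 1 := by
  have : Nontrivial S := Module.nontrivial_of_finrank_pos hS
  obtain ⟨x, hxS, hx⟩ := S.exists_mem_ne_zero_of_ne_bot (S.nontrivial_iff_ne_bot.1 this)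
  exact ⟨F ∙ x, (Submodule.span_singleton_le_iff_mem x S).2 hxS, finrank_span_singleton hx⟩

theorem IsSpread.ncard_le_eq_one {F V : Type*} [Field F] [AddCommGroup V] [Module F V]
    {g : ℕ} {𝒢 : Set (Submodule F V)} (h : IsSpread F g 𝒢) {P : Submodule F V}
    (hP : Module.finrank F P = 1) : {S ∈ 𝒢 | P ≤ S}.ncard = 1 := by
  obtain ⟨S, hS, huniq⟩ := h.2 P hP
  exact Set.ncard_eq_one.2 ⟨S, Set.eq_singleton_iff_unique_mem.2 ⟨hS, huniq⟩⟩

theorem IsSpread.exists_finrank_eq_two_not_le {F V : Type*} [Field F] [AddCommGroup V]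
    [Module F V] [FiniteDimensional F V] {g : ℕ} {𝒢 : Set (Submodule F V)} (hg : 0 < g)
    (h : IsSpread F g 𝒢) (hcard : 1 < 𝒢.ncard) :
    ∃ L : Submodule F V, Module.finrank F L = 2 ∧ ¬ ∃ S ∈ 𝒢, L ≤ S := by
  obtain ⟨S, S', hS, hS', hne⟩ :=
    (Set.one_lt_ncard_iff (Set.finite_of_ncard_pos (by omega))).1 hcard
  obtain ⟨P, hPS, hP⟩ := exists_finrank_eq_one_le (hg.trans_eq (h.1 S hS).symm)
  obtain ⟨P', hPS', hP'⟩ := exists_finrank_eq_one_le (hg.trans_eq (h.1 S' hS').symm)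
  have hPP' : P ≠ P' := by
    rintro rfl
    exact hne ((h.2 P hP).unique ⟨hS, hPS⟩ ⟨hS', hPS'⟩)
  have hinf : P ⊓ P' = ⊥ :=
    ((Submodule.isAtom_iff_finrank_eq_one.2 hP).disjoint_of_ne
      (Submodule.isAtom_iff_finrank_eq_one.2 hP') hPP').eq_bot
  refine ⟨P ⊔ P', ?_, ?_⟩
  · have := Submodule.finrank_sup_add_finrank_inf_eq P P'
    rw [hinf, finrank_bot, hP, hP'] at this
    exact this
  · rintro ⟨R, hR, hle⟩
    have h₁ := (h.2 P hP).unique ⟨hS, hPS⟩ ⟨hR, le_sup_left.trans hle⟩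
    have h₂ := (h.2 P' hP').unique ⟨hS', hPS'⟩ ⟨hR, le_sup_right.trans hle⟩
    exact hne (h₁.trans h₂.symm)

theorem IsGDD.mul_ncard_add_ncard {F V : Type*} [Field F] [AddCommGroup V] [Module F V]
    {g k lam : ℕ} {𝒢 ℬ : Set (Submodule F V)} (h : IsGDD F g k lam 𝒢 ℬ) {L : Submodule F V}
    (hL : Module.finrank F L = 2) :
    lam * {S ∈ 𝒢 | L ≤ S}.ncard + {B ∈ ℬ | L ≤ B}.ncard = lam := by
  obtain ⟨hin, hout⟩ := h.2.2.2 L hL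
  by_cases hLG : ∃ S ∈ 𝒢, L ≤ S
  · obtain ⟨⟨S, hS, huniq⟩, hB⟩ := hin hLG
    have hgroup : {S ∈ 𝒢 | L ≤ S} = {S} := Set.eq_singleton_iff_unique_mem.2 ⟨hS, huniq⟩
    have hblock : {B ∈ ℬ | L ≤ B} = ∅ := Set.eq_empty_of_forall_notMem fun B hB' =>
      hB B hB'.1 hB'.2
    rw [hgroup, hblock, Set.ncard_singleton, Set.ncard_empty, mul_one, add_zero]
  · have hgroup : {S ∈ 𝒢 | L ≤ S} = ∅ := Set.eq_empty_of_forall_notMem fun S hS => hLG ⟨S, hS⟩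
    rw [hgroup, hout hLG, Set.ncard_empty, mul_zero, zero_add]

theorem stmt_5 (F : Type) [Field F] [Fintype F] (v g k lam : ℕ)
    (hg : 0 < g) (hk : 0 < k) (hlam : 0 < lam)
    (𝒢 ℬ : Set (Submodule F (Fin v → F))) (h : IsGDD F g k lam 𝒢 ℬ) :
    ℬ.ncard = lam * (gaussBinom (Fintype.card F) v 2 -
        gaussBinom (Fintype.card F) g 2 * gaussBinom (Fintype.card F) v 1 /
          gaussBinom (Fintype.card F) g 1) / gaussBinom (Fintype.card F) k 2 := by
  classical
  have := Fintype.ofFinite (Submodule F (Fin v → F))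
  have hmem (m : ℕ) : ∀ L : Submodule F (Fin v → F),
      L ∈ Finset.univ.filter (fun L : Submodule F (Fin v → F) => Module.finrank F L = m) ↔
        Module.finrank F L = m := by simp
  have hpoints : gaussBinom (Fintype.card F) v 1 = 𝒢.ncard * gaussBinom (Fintype.card F) g 1 := by
    rw [← sum_ncard_le_eq h.1.1 (hmem 1), Finset.sum_congr rfl fun P hP =>
      h.1.ncard_le_eq_one ((hmem 1 P).1 hP), Finset.sum_const, smul_eq_mul, mul_one,
      card_eq_gaussBinom (hmem 1), Module.finrank_fin_fun]
  have hlines : lam * (𝒢.ncard * gaussBinom (Fintype.card F) g 2) +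
      ℬ.ncard * gaussBinom (Fintype.card F) k 2 = gaussBinom (Fintype.card F) v 2 * lam := by
    rw [← sum_ncard_le_eq h.1.1 (hmem 2), ← sum_ncard_le_eq h.2.2.1 (hmem 2), Finset.mul_sum,
      ← Finset.sum_add_distrib, Finset.sum_congr rfl fun L hL =>
      h.mul_ncard_add_ncard ((hmem 2 L).1 hL), Finset.sum_const, smul_eq_mul,
      card_eq_gaussBinom (hmem 2), Module.finrank_fin_fun]
  have hgpos : 0 < gaussBinom (Fintype.card F) g 1 := by
    obtain ⟨S, hS⟩ := Set.nonempty_of_ncard_ne_zero (Nat.ne_zero_of_lt h.2.1)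
    obtain ⟨P, hPS, hP⟩ := exists_finrank_eq_one_le (hg.trans_eq (h.1.1 S hS).symm)
    exact hP ▸ h.1.1 S hS ▸ gaussBinom_pos_of_le hPS
  have hkpos : 0 < gaussBinom (Fintype.card F) k 2 := by
    obtain ⟨L, hL, hLG⟩ := h.1.exists_finrank_eq_two_not_le hg h.2.1
    obtain ⟨B, hB, hLB⟩ := Set.nonempty_of_ncard_ne_zero
      ((h.2.2.2 L hL).2 hLG ▸ hlam.ne')
    exact hL ▸ h.2.2.1 B hB ▸ gaussBinom_pos_of_le hLB
  have hdiv : gaussBinom (Fintype.card F) g 2 * gaussBinom (Fintype.card F) v 1 /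
      gaussBinom (Fintype.card F) g 1 = 𝒢.ncard * gaussBinom (Fintype.card F) g 2 := by
    rw [hpoints, ← mul_assoc, Nat.mul_div_cancel _ hgpos, mul_comm]
  rw [hdiv, Nat.mul_sub, mul_comm lam (gaussBinom _ v 2), ← hlines, Nat.add_sub_cancel_left,
    Nat.mul_div_cancel _ hkpos]
end

section
/- Let q be a prime power, let (V', ℬ') be a 2-(v+1, k, 1)_q subspace design, let P be a 1-dimensional subspace of V', and let π : U ↦ (U + P)/P be the projection to V'/P. Then the set 𝒢 = { π(B) : B ∈ ℬ', P ≤ B } is a (k-2)-spread of the v-dimensional space V'/P, i.e. every element of 𝒢 is a (k-1)-dimensional subspace of V'/P and every 1-dimensional subspace of V'/P is contained in exactly one element of 𝒢. -/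
theorem finrank_map_mkQ_add_finrank {F V : Type*} [Field F] [AddCommGroup V] [Module F V]
    [FiniteDimensional F V] {P B : Submodule F V} (hPB : P ≤ B) :
    Module.finrank F (B.map P.mkQ) + Module.finrank F P = Module.finrank F B := by
  have h := (P.mkQ.domRestrict B).finrank_range_add_finrank_ker
  rwa [LinearMap.range_domRestrict, LinearMap.ker_domRestrict, Submodule.ker_mkQ,
    (Submodule.comapSubtypeEquivOfLe hPB).finrank_eq] at h

theorem stmt_9 (F : Type) [Field F] [Fintype F] (v k : ℕ)
    (ℬ' : Set (Submodule F (Fin (v + 1) → F))) (hd : IsSubspaceDesign F k 1 ℬ')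
    (P : Submodule F (Fin (v + 1) → F)) (hP : Module.finrank F P = 1) :
    IsSpread F (k - 1)
      {U : Submodule F ((Fin (v + 1) → F) ⧸ P) |
        ∃ B ∈ ℬ', P ≤ B ∧ U = Submodule.map P.mkQ B} := by
  refine ⟨?_, fun Q hQ => ?_⟩
  · rintro _ ⟨B, hB, hPB, rfl⟩
    have h := finrank_map_mkQ_add_finrank hPB
    rw [hP, hd.1 B hB] at h
    omega
  · have hPL : P ≤ Q.comap P.mkQ := P.le_comap_mkQ Q
    have hL : Module.finrank F (Q.comap P.mkQ) = 2 := by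
      rw [← finrank_map_mkQ_add_finrank hPL,
        Submodule.map_comap_eq_of_surjective P.mkQ_surjective, hQ, hP]
    obtain ⟨B, hB⟩ := Set.ncard_eq_one.mp (hd.2 _ hL)
    have hmem : B ∈ ℬ' ∧ Q.comap P.mkQ ≤ B := (Set.ext_iff.mp hB B).mpr rfl
    refine ⟨B.map P.mkQ, ⟨⟨B, hmem.1, hPL.trans hmem.2, rfl⟩, ?_⟩, ?_⟩
    · rw [← Submodule.map_comap_eq_of_surjective P.mkQ_surjective Q]
      exact Submodule.map_mono hmem.2
    · rintro _ ⟨⟨C, hC, hPC, rfl⟩, hQC⟩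
      have hLC : Q.comap P.mkQ ≤ C := by
        have h := Submodule.comap_mono (f := P.mkQ) hQC
        rwa [Submodule.comap_map_mkQ, sup_eq_right.mpr hPC] at h
      have hCB : C = B := (Set.ext_iff.mp hB C).mp ⟨hC, hLC⟩
      rw [hCB]
end

section
/- Let q be a prime power, g, s ≥ 1, and let V = GF(q^g)^s regarded as a GF(q)-vector space of dimension gs. For 0 ≤ k ≤ s, the number of fat k-dimensional GF(q)-subspaces of V equals q^{(g-1)·binom(k,2)} · ∏_{i=0}^{k-1} (q^{g(s-i)} − 1)/(q^{k-i} − 1). -/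
open Module Submodule in
/-- A linearly independent family of `finrank F U` vectors of `U` spans `U`. -/
theorem span_range_coe_eq_of_linearIndependent {F V : Type*} [Field F] [AddCommGroup V]
    [Module F V] {U : Submodule F V} [FiniteDimensional F U] {k : ℕ} (hU : finrank F U = k)
    {w : Fin k → U} (hw : LinearIndependent F w) :
    span F (Set.range fun i => (w i : V)) = U := by
  have h := hw.span_eq_top_of_card_eq_finrank' (by simp [hU])
  have h' := congrArg (Submodule.map U.subtype) h
  rwa [Submodule.map_span, ← Set.range_comp, Submodule.map_subtype_top] at h'

open Module Submodule in
/-- Choosing an `E`-linearly independent `k`-tuple is the same as choosing a fat `k`-dimensional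
subspace together with an ordered `F`-basis of it. -/
noncomputable def sigmaFatEquivLinearIndependent (F E : Type*) [Field F] [Field E] [Algebra F E]
    [FiniteDimensional F E] (s k : ℕ) :
    (Σ U : {U : Submodule F (Fin s → E) // IsFat F U ∧ finrank F U = k},
      {w : Fin k → U.1 // LinearIndependent F w}) ≃
      {v : Fin k → Fin s → E // LinearIndependent E v} :=
  Equiv.ofBijective
    (fun p => ⟨fun i => (p.2.1 i : Fin s → E), by
      obtain ⟨⟨U, hfat, hU⟩, w, hw⟩ := p
      rw [linearIndependent_iff_card_eq_finrank_span, Set.finrank, ← span_span_of_tower F,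
        span_range_coe_eq_of_linearIndependent hU hw, hfat, hU, Fintype.card_fin]⟩) <| by
    constructor
    · rintro ⟨⟨U, hfat, hU⟩, w, hw⟩ ⟨⟨U', hfat', hU'⟩, w', hw'⟩ h
      have h : (fun i => (w i : Fin s → E)) = fun i => (w' i : Fin s → E) := congrArg Subtype.val h
      obtain rfl : U = U' := by
        rw [← span_range_coe_eq_of_linearIndependent hU hw, h,
          span_range_coe_eq_of_linearIndependent hU' hw']
      obtain rfl : w = w' := funext fun i => Subtype.ext (congrFun h i)
      rfl
    · rintro ⟨v, hv⟩
      have hF : LinearIndependent F v := hv.restrict_scalars' F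
      have hU : finrank F (span F (Set.range v)) = k := by
        rw [finrank_span_eq_card hF, Fintype.card_fin]
      refine ⟨⟨⟨span F (Set.range v), ?_, hU⟩, fun i => ⟨v i, subset_span ⟨i, rfl⟩⟩,
        linearIndependent_span hF⟩, rfl⟩
      rw [IsFat, span_span_of_tower, hU, finrank_span_eq_card hv, Fintype.card_fin]

/-- Double counting of `E`-linearly independent `k`-tuples. -/
theorem card_fat_mul_prod (F E : Type*) [Field F] [Fintype F] [Field E] [Fintype E] [Algebra F E]
    {s k : ℕ} (hk : k ≤ s) :
    Nat.card {U : Submodule F (Fin s → E) // IsFat F U ∧ Module.finrank F U = k} *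
        ∏ i ∈ Finset.range k, (Fintype.card F ^ k - Fintype.card F ^ i) =
      ∏ i ∈ Finset.range k, (Fintype.card E ^ s - Fintype.card E ^ i) := by
  have h := Nat.card_congr (sigmaFatEquivLinearIndependent F E s k)
  have hfib (U : {U : Submodule F (Fin s → E) // IsFat F U ∧ Module.finrank F U = k}) :
      Nat.card {w : Fin k → U.1 // LinearIndependent F w} =
        ∏ i ∈ Finset.range k, (Fintype.card F ^ k - Fintype.card F ^ i) := by
    rw [card_linearIndependent U.2.2.ge, U.2.2,
      Fin.prod_univ_eq_prod_range fun i => Fintype.card F ^ k - Fintype.card F ^ i]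
  have : Fintype {U : Submodule F (Fin s → E) // IsFat F U ∧ Module.finrank F U = k} :=
    Fintype.ofFinite _
  rw [Nat.card_sigma, Finset.sum_congr rfl fun U _ => hfib U,
    card_linearIndependent (by simpa using hk), Module.finrank_fin_fun,
    Fin.prod_univ_eq_prod_range fun i => Fintype.card E ^ s - Fintype.card E ^ i] at h
  simpa using h

theorem prod_range_pow_sub_pow (a : ℕ) {n k : ℕ} (hk : k ≤ n) :
    ∏ i ∈ Finset.range k, (a ^ n - a ^ i) =
      a ^ k.choose 2 * ∏ i ∈ Finset.range k, (a ^ (n - i) - 1) := by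
  rw [Nat.choose_two_right, ← Finset.sum_range_id, ← Finset.prod_pow_eq_pow_sum,
    ← Finset.prod_mul_distrib]
  refine Finset.prod_congr rfl fun i hi => ?_
  have hi := Finset.mem_range.mp hi
  rw [Nat.mul_sub, ← pow_add, mul_one, Nat.add_sub_cancel' (by omega)]

theorem coprime_pow_prod_range_pow_sub_one {q : ℕ} (hq : 0 < q) (m k : ℕ) :
    Nat.Coprime (∏ i ∈ Finset.range k, (q ^ (k - i) - 1)) (q ^ m) := by
  refine Nat.Coprime.prod_left fun i hi => Nat.Coprime.pow_right m ?_
  have hi := Finset.mem_range.mp hi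
  have h : Nat.Coprime (q ^ (k - i) - 1) (q ^ (k - i)) :=
    (Nat.coprime_self_sub_left (Nat.one_le_pow _ _ hq)).mpr (Nat.coprime_one_left _)
  exact h.coprime_dvd_right (dvd_pow_self q (by omega))

theorem stmt_11 (F E : Type) [Field F] [Fintype F] [Field E] [Fintype E] [Algebra F E]
    (g s k : ℕ) (hg : 1 ≤ g) (hs : 1 ≤ s) (hFE : Module.finrank F E = g) (hk : k ≤ s) :
    Nat.card {U : Submodule F (Fin s → E) // IsFat F U ∧ Module.finrank F U = k} =
      (Fintype.card F) ^ ((g - 1) * Nat.choose k 2) *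
        ((∏ i ∈ Finset.range k, ((Fintype.card F) ^ (g * (s - i)) - 1)) /
          ∏ i ∈ Finset.range k, ((Fintype.card F) ^ (k - i) - 1)) := by
  have hq : 1 < Fintype.card F := Fintype.one_lt_card
  have hmul := card_fat_mul_prod F E hk
  rw [prod_range_pow_sub_pow _ le_rfl, prod_range_pow_sub_pow _ hk,
    Module.card_eq_pow_finrank (K := F) (V := E), hFE] at hmul
  simp only [← pow_mul] at hmul
  set q := Fintype.card F
  set B := ∏ i ∈ Finset.range k, (q ^ (k - i) - 1)
  set A := ∏ i ∈ Finset.range k, (q ^ (g * (s - i)) - 1)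
  have hexp : g * k.choose 2 = k.choose 2 + (g - 1) * k.choose 2 := by
    obtain ⟨g, rfl⟩ := Nat.exists_eq_add_of_le' hg
    simp only [Nat.add_sub_cancel]
    ring
  rw [hexp, pow_add, mul_left_comm, mul_assoc] at hmul
  have hmul := Nat.eq_of_mul_eq_mul_left (by positivity) hmul
  have hdvd : B ∣ A :=
    (coprime_pow_prod_range_pow_sub_one (by omega) _ k).dvd_of_dvd_mul_left
      (Dvd.intro_left _ hmul)
  have hpos : 0 < B := Finset.prod_pos fun i hi =>
    Nat.sub_pos_of_lt (Nat.one_lt_pow (by have := Finset.mem_range.mp hi; omega) hq)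
  rw [← Nat.mul_div_assoc _ hdvd]
  exact (Nat.div_eq_of_eq_mul_left hpos hmul.symm).symm
end

section
/- Let q be a prime power, g ≥ 1, s ≥ 1, and V = GF(q^g)^s regarded as a GF(q)-vector space. Under the action of SL(s, q^g) on the set ℱ_s of fat s-dimensional GF(q)-subspaces of V, the set ℱ_s splits into exactly (q^g − 1)/(q − 1) orbits, and all orbits have the same cardinality. Moreover, two fat s-subspaces U, U' lie in the same orbit if and only if det(U) = det(U'), where det(U) ∈ GF(q^g)^*/GF(q)^* is the class of the determinant of any matrix whose rows form a GF(q)-basis of U. -/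
section RowSpan

variable {F E : Type*} [Field F] [Field E] [Algebra F E] {s : ℕ}

variable (F) in
/-- The `F`-subspace spanned by the rows of a matrix over an extension field `E`. -/
def rowSpan (M : Matrix (Fin s) (Fin s) E) : Submodule F (Fin s → E) :=
  Submodule.span F (Set.range fun i => M i)

lemma rowSpan_map_mul_le (P : Matrix (Fin s) (Fin s) F) (M : Matrix (Fin s) (Fin s) E) :
    rowSpan F (P.map (algebraMap F E) * M) ≤ rowSpan F M := by
  refine Submodule.span_le.2 ?_
  rintro _ ⟨i, rfl⟩
  refine (Submodule.mem_span_range_iff_exists_fun F).2 ⟨P i, ?_⟩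
  ext j
  simp [Matrix.mul_apply, Algebra.smul_def]

lemma rowSpan_map_mul {P : Matrix (Fin s) (Fin s) F} (hP : P.det ≠ 0)
    (M : Matrix (Fin s) (Fin s) E) :
    rowSpan F (P.map (algebraMap F E) * M) = rowSpan F M := by
  refine (rowSpan_map_mul_le P M).antisymm ?_
  have h := rowSpan_map_mul_le P⁻¹ (P.map (algebraMap F E) * M)
  rwa [← Matrix.mul_assoc, ← Matrix.map_mul, Matrix.nonsing_inv_mul P (isUnit_iff_ne_zero.2 hP),
    Matrix.map_one _ (map_zero _) (map_one _), Matrix.one_mul] at h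

lemma exists_det_eq_of_rowSpan_eq {M M' : Matrix (Fin s) (Fin s) E} (hM : M.det ≠ 0)
    (h : rowSpan F M = rowSpan F M') :
    ∃ c : F, c ≠ 0 ∧ M.det = algebraMap F E c * M'.det := by
  have hmem : ∀ i, ∃ c : Fin s → F, ∑ j, c j • M' j = M i := fun i =>
    (Submodule.mem_span_range_iff_exists_fun F).1
      (h ▸ Submodule.subset_span ⟨i, rfl⟩ : M i ∈ rowSpan F M')
  choose P hP using hmem
  have hMP : M = (Matrix.of P).map (algebraMap F E) * M' := by
    ext i j
    simp [← hP, Matrix.mul_apply, Algebra.smul_def]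
  have hdet : M.det = algebraMap F E (Matrix.of P).det * M'.det := by
    rw [hMP, Matrix.det_mul, RingHom.map_det, RingHom.mapMatrix_apply]
  refine ⟨_, fun h0 => hM ?_, hdet⟩
  rw [hdet, h0, map_zero, zero_mul]

lemma map_toLin'_rowSpan (A M : Matrix (Fin s) (Fin s) E) :
    (rowSpan F M).map (LinearMap.restrictScalars F (Matrix.toLin' A)) =
      rowSpan F (M * A.transpose) := by
  rw [rowSpan, rowSpan, Submodule.map_span, ← Set.range_comp]
  congr 2
  ext i j
  simp [Matrix.mulVec, dotProduct, Matrix.mul_apply, mul_comm]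

lemma slMap_rowSpan (A : Matrix.SpecialLinearGroup (Fin s) E) (M : Matrix (Fin s) (Fin s) E) :
    slMap F A (rowSpan F M) = rowSpan F (M * A.1.transpose) :=
  map_toLin'_rowSpan A.1 M

lemma slMap_mk_rowSpan {A : Matrix (Fin s) (Fin s) E} (hA : A.det = 1)
    (M : Matrix (Fin s) (Fin s) E) :
    slMap F (⟨A, hA⟩ : Matrix.SpecialLinearGroup (Fin s) E) (rowSpan F M) =
      rowSpan F (M * A.transpose) :=
  map_toLin'_rowSpan A M

lemma span_rowSpan (M : Matrix (Fin s) (Fin s) E) :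
    Submodule.span E (rowSpan F M : Set (Fin s → E)) = Submodule.span E (Set.range fun i => M i) :=
  Submodule.span_span_of_tower F E _

lemma linearIndependent_rows_iff_det_ne_zero {M : Matrix (Fin s) (Fin s) E} :
    LinearIndependent E (fun i => M i) ↔ M.det ≠ 0 := by
  rw [← isUnit_iff_ne_zero, ← Matrix.isUnit_iff_isUnit_det]
  exact Matrix.linearIndependent_rows_iff_isUnit

lemma finrank_rowSpan {M : Matrix (Fin s) (Fin s) E} (hM : LinearIndependent F (fun i => M i)) :
    Module.finrank F (rowSpan F M) = s := by
  rw [rowSpan, finrank_span_eq_card hM, Fintype.card_fin]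

lemma det_ne_zero_of_isFat {M : Matrix (Fin s) (Fin s) E}
    (hM : LinearIndependent F (fun i => M i)) (hU : IsFat F (rowSpan F M)) : M.det ≠ 0 := by
  rw [IsFat, span_rowSpan, finrank_rowSpan hM] at hU
  rw [← linearIndependent_rows_iff_det_ne_zero, linearIndependent_iff_card_eq_finrank_span,
    Fintype.card_fin, Set.finrank, hU]

lemma linearIndependent_rows_of_det_ne_zero {M : Matrix (Fin s) (Fin s) E} (hM : M.det ≠ 0) :
    LinearIndependent F (fun i => M i) :=
  (linearIndependent_rows_iff_det_ne_zero.2 hM).restrict_scalars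
    (by simpa [Algebra.smul_def] using (algebraMap F E).injective)

lemma isFat_rowSpan {M : Matrix (Fin s) (Fin s) E} (hM : M.det ≠ 0) : IsFat F (rowSpan F M) := by
  rw [IsFat, span_rowSpan, finrank_rowSpan (linearIndependent_rows_of_det_ne_zero hM),
    finrank_span_eq_card (linearIndependent_rows_iff_det_ne_zero.2 hM), Fintype.card_fin]

lemma IsFat.exists_rowSpan_eq [Finite E] {U : Submodule F (Fin s → E)} (hU : IsFat F U)
    (hs : Module.finrank F U = s) :
    ∃ M : Matrix (Fin s) (Fin s) E, M.det ≠ 0 ∧ rowSpan F M = U := by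
  let b := Module.finBasisOfFinrankEq F U hs
  let M : Matrix (Fin s) (Fin s) E := fun i => (b i : Fin s → E)
  have hM : LinearIndependent F (fun i => M i) :=
    b.linearIndependent.map' U.subtype (Submodule.ker_subtype U)
  have hspan : rowSpan F M = U := by
    have h := congrArg (Submodule.map U.subtype) b.span_eq
    rwa [Submodule.map_span, ← Set.range_comp, Submodule.map_top, Submodule.range_subtype] at h
  exact ⟨M, det_ne_zero_of_isFat hM (hspan ▸ hU), hspan⟩

lemma exists_matrix_det_eq {n R : Type*} [Fintype n] [DecidableEq n] [Nonempty n] [CommRing R]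
    (c : R) : ∃ P : Matrix n n R, P.det = c := by
  obtain ⟨i⟩ := ‹Nonempty n›
  refine ⟨Matrix.diagonal (Function.update 1 i c), ?_⟩
  rw [Matrix.det_diagonal, Finset.prod_update_of_mem (Finset.mem_univ i)]
  simp

lemma exists_slMap_rowSpan_eq_iff (hs : 1 ≤ s) {M M' : Matrix (Fin s) (Fin s) E}
    (hM : M.det ≠ 0) :
    (∃ A : Matrix.SpecialLinearGroup (Fin s) E, slMap F A (rowSpan F M) = rowSpan F M') ↔
      ∃ c : F, c ≠ 0 ∧ M.det = algebraMap F E c * M'.det := by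
  constructor
  · rintro ⟨A, hA⟩
    have hdet : (M * A.1.transpose).det = M.det := by
      rw [Matrix.det_mul, Matrix.det_transpose, A.2, mul_one]
    rw [slMap_rowSpan] at hA
    rw [← hdet]
    exact exists_det_eq_of_rowSpan_eq (hdet.symm ▸ hM) hA
  · rintro ⟨c, hc, hdet⟩
    have : Nonempty (Fin s) := ⟨⟨0, hs⟩⟩
    obtain ⟨P, rfl⟩ := exists_matrix_det_eq (n := Fin s) c
    have hdet' : (P.map (algebraMap F E) * M').det = M.det := by
      rw [hdet, Matrix.det_mul, RingHom.map_det, RingHom.mapMatrix_apply]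
    have hA : (M⁻¹ * (P.map (algebraMap F E) * M')).transpose.det = 1 := by
      rw [Matrix.det_transpose, Matrix.det_mul, hdet', ← Matrix.det_mul,
        Matrix.nonsing_inv_mul M (isUnit_iff_ne_zero.2 hM), Matrix.det_one]
    refine ⟨⟨_, hA⟩, (slMap_mk_rowSpan hA M).trans ?_⟩
    rw [Matrix.transpose_transpose, ← Matrix.mul_assoc,
      Matrix.mul_nonsing_inv M (isUnit_iff_ne_zero.2 hM), Matrix.one_mul, rowSpan_map_mul hc]

/-- Right multiplication by an invertible matrix carries `SL`-orbits of row spaces to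
`SL`-orbits. -/
lemma slMap_conj_rowSpan {T : Matrix (Fin s) (Fin s) E} (hT : T.det ≠ 0)
    (M : Matrix (Fin s) (Fin s) E) (A : Matrix.SpecialLinearGroup (Fin s) E) :
    ∃ B : Matrix.SpecialLinearGroup (Fin s) E,
      slMap F B (rowSpan F (M * T.transpose)) =
        (slMap F A (rowSpan F M)).map (LinearMap.restrictScalars F (Matrix.toLin' T)) := by
  have hT' := isUnit_iff_ne_zero.2 hT
  have hB : (T * A.1 * T⁻¹).det = 1 := by
    rw [Matrix.det_mul, Matrix.det_mul, A.2, mul_one, ← Matrix.det_mul,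
      Matrix.mul_nonsing_inv T hT', Matrix.det_one]
  refine ⟨⟨_, hB⟩, (slMap_mk_rowSpan hB _).trans ?_⟩
  rw [slMap_rowSpan, map_toLin'_rowSpan, Matrix.mul_assoc M, Matrix.mul_assoc M,
    ← Matrix.transpose_mul, ← Matrix.transpose_mul, Matrix.mul_assoc (T * _),
    Matrix.nonsing_inv_mul T hT', Matrix.mul_one]

lemma ncard_orbit_le [Finite E] {M M' : Matrix (Fin s) (Fin s) E}
    (hM : M.det ≠ 0) (hM' : M'.det ≠ 0) :
    {W | ∃ A : Matrix.SpecialLinearGroup (Fin s) E, slMap F A (rowSpan F M) = W}.ncard ≤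
      {W | ∃ A : Matrix.SpecialLinearGroup (Fin s) E, slMap F A (rowSpan F M') = W}.ncard := by
  let T := (M⁻¹ * M').transpose
  have hT : T.det ≠ 0 := by
    rw [Matrix.det_transpose, Matrix.det_mul]
    exact mul_ne_zero ((Matrix.isUnit_nonsing_inv_det M (isUnit_iff_ne_zero.2 hM)).ne_zero) hM'
  have hMT : M * T.transpose = M' := by
    rw [Matrix.transpose_transpose, ← Matrix.mul_assoc,
      Matrix.mul_nonsing_inv M (isUnit_iff_ne_zero.2 hM), Matrix.one_mul]
  have hinj : Function.Injective (LinearMap.restrictScalars F (Matrix.toLin' T)) :=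
    Matrix.mulVec_injective_of_isUnit ((Matrix.isUnit_iff_isUnit_det T).2 (isUnit_iff_ne_zero.2 hT))
  refine Set.ncard_le_ncard_of_injOn
    (Submodule.map (LinearMap.restrictScalars F (Matrix.toLin' T))) ?_
    (Submodule.map_injective_of_injective hinj).injOn ?_
  · rintro _ ⟨A, rfl⟩
    rw [← hMT]
    exact slMap_conj_rowSpan hT M A
  · have : Finite (Submodule F (Fin s → E)) := Finite.of_injective _ SetLike.coe_injective
    exact Set.toFinite _

end RowSpan

lemma natCard_units_quotient_range (F E : Type*) [Field F] [Fintype F] [Field E] [Fintype E]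
    [Algebra F E] :
    Nat.card (Eˣ ⧸ (Units.map (algebraMap F E : F →* E)).range) =
      (Fintype.card F ^ Module.finrank F E - 1) / (Fintype.card F - 1) := by
  have hinj : Function.Injective (Units.map (algebraMap F E : F →* E)) :=
    Units.map_injective (algebraMap F E).injective
  have h := Subgroup.card_eq_card_quotient_mul_card_subgroup
    (Units.map (algebraMap F E : F →* E)).range
  rw [← Nat.card_congr (MonoidHom.ofInjective hinj).toEquiv, Nat.card_units, Nat.card_units,
    Nat.card_eq_fintype_card (α := E), Nat.card_eq_fintype_card (α := F),
    Module.card_eq_pow_finrank (K := F) (V := E)] at h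
  rw [h, Nat.mul_div_cancel _ (Nat.sub_pos_of_lt Fintype.one_lt_card)]

lemma units_quotient_mk_eq_iff {F E : Type*} [Field F] [Field E] [Algebra F E] {x y : E}
    (hx : x ≠ 0) (hy : y ≠ 0) :
    (QuotientGroup.mk (Units.mk0 x hx) : Eˣ ⧸ (Units.map (algebraMap F E : F →* E)).range) =
        QuotientGroup.mk (Units.mk0 y hy) ↔
      ∃ c : F, c ≠ 0 ∧ x = algebraMap F E c * y := by
  rw [eq_comm, QuotientGroup.eq]
  constructor
  · rintro ⟨c, hc⟩
    refine ⟨c, c.ne_zero, ?_⟩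
    have h : algebraMap F E c = y⁻¹ * x := congrArg Units.val hc
    rw [h, mul_right_comm, inv_mul_cancel₀ hy, one_mul]
  · rintro ⟨c, hc, rfl⟩
    refine ⟨Units.mk0 c hc, Units.ext ?_⟩
    simp

theorem stmt_13 (F E : Type) [Field F] [Fintype F] [Field E] [Fintype E] [Algebra F E]
    (g s : ℕ) (hg : 1 ≤ g) (hs : 1 ≤ s) (hFE : Module.finrank F E = g) :
    Nat.card (Quot (fun X Y :
        {U : Submodule F (Fin s → E) // IsFat F U ∧ Module.finrank F U = s} =>
        ∃ A : Matrix.SpecialLinearGroup (Fin s) E, slMap F A X.1 = Y.1)) =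
      ((Fintype.card F) ^ g - 1) / (Fintype.card F - 1) ∧
    (∀ U U' : Submodule F (Fin s → E),
      IsFat F U → Module.finrank F U = s → IsFat F U' → Module.finrank F U' = s →
      {W : Submodule F (Fin s → E) |
          ∃ A : Matrix.SpecialLinearGroup (Fin s) E, slMap F A U = W}.ncard =
        {W : Submodule F (Fin s → E) |
          ∃ A : Matrix.SpecialLinearGroup (Fin s) E, slMap F A U' = W}.ncard) ∧
    (∀ U U' : Submodule F (Fin s → E),
      IsFat F U → Module.finrank F U = s → IsFat F U' → Module.finrank F U' = s →
      ((∃ A : Matrix.SpecialLinearGroup (Fin s) E, slMap F A U = U') ↔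
        ∀ M M' : Matrix (Fin s) (Fin s) E,
          LinearIndependent F (fun i => M i) →
          Submodule.span F (Set.range fun i => M i) = U →
          LinearIndependent F (fun i => M' i) →
          Submodule.span F (Set.range fun i => M' i) = U' →
          ∃ c : F, c ≠ 0 ∧ M.det = algebraMap F E c * M'.det)) := by
  refine ⟨?_, ?_, ?_⟩
  · choose! N hdet hspan using fun (U : Submodule F (Fin s → E))
      (h : IsFat F U ∧ Module.finrank F U = s) => h.1.exists_rowSpan_eq h.2
    rw [← hFE, ← natCard_units_quotient_range F E]
    let f (X : {U : Submodule F (Fin s → E) // IsFat F U ∧ Module.finrank F U = s}) :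
        Eˣ ⧸ (Units.map (algebraMap F E : F →* E)).range :=
      QuotientGroup.mk (Units.mk0 (N X.1).det (hdet X.1 X.2))
    have hf : ∀ X Y, (∃ A : Matrix.SpecialLinearGroup (Fin s) E, slMap F A X.1 = Y.1) ↔
        f X = f Y := fun X Y => by
      rw [units_quotient_mk_eq_iff, ← exists_slMap_rowSpan_eq_iff hs (hdet X.1 X.2),
        hspan X.1 X.2, hspan Y.1 Y.2]
    refine Nat.card_eq_of_bijective (Quot.lift f fun X Y h => (hf X Y).1 h) ⟨?_, ?_⟩
    · rintro ⟨X⟩ ⟨Y⟩ h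
      exact Quot.sound ((hf X Y).2 h)
    · rintro ⟨u⟩
      have : Nonempty (Fin s) := ⟨⟨0, hs⟩⟩
      obtain ⟨M, hM⟩ := exists_matrix_det_eq (n := Fin s) (u : E)
      have hM0 : M.det ≠ 0 := hM ▸ u.ne_zero
      have hX : IsFat F (rowSpan F M) ∧ Module.finrank F (rowSpan F M) = s :=
        ⟨isFat_rowSpan hM0, finrank_rowSpan (linearIndependent_rows_of_det_ne_zero hM0)⟩
      refine ⟨Quot.mk _ ⟨rowSpan F M, hX⟩, ?_⟩
      have hu : u = Units.mk0 M.det hM0 := Units.ext hM.symm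
      rw [hu]
      exact (units_quotient_mk_eq_iff _ _).2
        (exists_det_eq_of_rowSpan_eq (hdet _ hX) (hspan _ hX))
  · intro U U' hU hUs hU' hUs'
    obtain ⟨M, hM, rfl⟩ := hU.exists_rowSpan_eq hUs
    obtain ⟨M', hM', rfl⟩ := hU'.exists_rowSpan_eq hUs'
    exact (ncard_orbit_le hM hM').antisymm (ncard_orbit_le hM' hM)
  · intro U U' hU hUs hU' hUs'
    constructor
    · rintro hA M M' hM rfl hM' rfl
      exact (exists_slMap_rowSpan_eq_iff hs (det_ne_zero_of_isFat hM hU)).1 hA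
    · intro h
      obtain ⟨M, hM, rfl⟩ := hU.exists_rowSpan_eq hUs
      obtain ⟨M', hM', rfl⟩ := hU'.exists_rowSpan_eq hUs'
      exact (exists_slMap_rowSpan_eq_iff hs hM).2
        (h M M' (linearIndependent_rows_of_det_ne_zero hM) rfl
          (linearIndependent_rows_of_det_ne_zero hM') rfl)
end

section
/- Let q be a prime power, g ≥ 2, s ≥ 3, V = GF(q^g)^s regarded as a GF(q)-vector space of dimension gs, and let 𝒢 be the Desarguesian (g-1)-spread of V. Let α be an integer with 1 ≤ α ≤ (q^g − 1)/(q − 1) and let ℬ be the union of any α orbits of the action of SL(s, q^g) on the set of fat s-dimensional GF(q)-subspaces of V. Then (V, 𝒢, ℬ) is a (gs, g, s, λ)_q-GDD with λ = α · q^{(g-1)(binom(s,2)−1)} · ∏_{i=2}^{s-2} (q^{gi} − 1)/(q^i − 1). -/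
open Matrix in
/-- The matrices of determinant one that fix the first two standard basis vectors. -/
def fixTwo (K : Type*) [Field K] (s : ℕ) : Subgroup (Matrix.SpecialLinearGroup (Fin s) K) where
  carrier := {P | ∀ j : Fin s, j.val < 2 → (P : Matrix (Fin s) (Fin s) K) *ᵥ Pi.single j 1 = Pi.single j 1}
  one_mem' j _ := by rw [Matrix.SpecialLinearGroup.coe_one, one_mulVec]
  mul_mem' {P P'} hP hP' j hj := by
    rw [Matrix.SpecialLinearGroup.coe_mul, ← mulVec_mulVec, hP' j hj, hP j hj]
  inv_mem' {P} hP j hj := by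
    conv_lhs => rw [← hP j hj]
    rw [mulVec_mulVec, ← Matrix.SpecialLinearGroup.coe_mul, inv_mul_cancel, Matrix.SpecialLinearGroup.coe_one,
      one_mulVec]

open Matrix in
theorem mem_fixTwo {K : Type*} [Field K] {s : ℕ} {P : Matrix.SpecialLinearGroup (Fin s) K} :
    P ∈ fixTwo K s ↔ ∀ j : Fin s, j.val < 2 → (P : Matrix (Fin s) (Fin s) K) *ᵥ Pi.single j 1 = Pi.single j 1 :=
  Iff.rfl

theorem prod_pow_sub_pow_s15 (Q m : ℕ) :
    ∏ i : Fin m, (Q ^ m - Q ^ (i : ℕ)) =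
      Q ^ m.choose 2 * ∏ i ∈ Finset.Ico 1 (m + 1), (Q ^ i - 1) := by
  rw [Fin.prod_univ_eq_prod_range (fun i => Q ^ m - Q ^ i) m]
  have h : ∀ i ∈ Finset.range m, Q ^ m - Q ^ i = Q ^ i * (Q ^ (m - i) - 1) := by
    intro i hi
    rw [Nat.mul_sub, ← pow_add, mul_one, Nat.add_sub_cancel' (Finset.mem_range.1 hi).le]
  rw [Finset.prod_congr rfl h, Finset.prod_mul_distrib, Finset.prod_pow_eq_pow_sum,
    Finset.sum_range_id, ← Nat.choose_two_right, Finset.prod_Ico_eq_prod_range,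
    ← Finset.prod_range_reflect]
  congr 1
  refine Finset.prod_congr (by simp) fun i hi => ?_
  have := Finset.mem_range.1 hi
  congr 2
  omega

open Matrix in
theorem card_specialLinearGroup (K : Type*) [Field K] [Fintype K] (m : ℕ) (hm : 1 ≤ m) :
    Nat.card (Matrix.SpecialLinearGroup (Fin m) K) =
      Fintype.card K ^ m.choose 2 * ∏ i ∈ Finset.Ico 2 (m + 1), (Fintype.card K ^ i - 1) := by
  classical
  have hker : (Matrix.SpecialLinearGroup.toGL : Matrix.SpecialLinearGroup (Fin m) K →* GL (Fin m) K).range =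
      (GeneralLinearGroup.det : GL (Fin m) K →* Kˣ).ker := by
    ext A
    constructor
    · rintro ⟨P, rfl⟩
      rw [MonoidHom.mem_ker]
      ext
      simp
    · intro hA
      rw [MonoidHom.mem_ker] at hA
      refine ⟨⟨A.1, by simpa using congrArg Units.val hA⟩, ?_⟩
      exact Units.ext rfl
  have hsurj : Function.Surjective (GeneralLinearGroup.det : GL (Fin m) K →* Kˣ) := by
    intro u
    have hd : (diagonal (Function.update (1 : Fin m → K) ⟨0, hm⟩ (u : K))).det = u := by
      rw [det_diagonal, Finset.prod_update_of_mem (Finset.mem_univ _)]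
      simp
    refine ⟨GeneralLinearGroup.mkOfDetNeZero _ (hd ▸ u.ne_zero), ?_⟩
    ext
    simpa using hd
  have h1 := Subgroup.card_eq_card_quotient_mul_card_subgroup
    (GeneralLinearGroup.det : GL (Fin m) K →* Kˣ).ker
  rw [Nat.card_congr (QuotientGroup.quotientKerEquivOfSurjective _ hsurj).toEquiv, ← hker,
    ← Nat.card_congr (MonoidHom.ofInjective Matrix.SpecialLinearGroup.toGL_injective).toEquiv,
    card_GL_field, prod_pow_sub_pow_s15, Nat.card_units,
    Finset.prod_eq_prod_Ico_succ_bot (by omega), pow_one, Nat.card_eq_fintype_card] at h1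
  have hq : 0 < Fintype.card K - 1 := Nat.sub_pos_of_lt Fintype.one_lt_card
  refine Nat.eq_of_mul_eq_mul_left hq ?_
  rw [← h1]
  ring

open Matrix in
/-- A matrix in `fixTwo K (2 + m)` is block triangular with identity upper left block; it is
determined by its two right-hand blocks. -/
noncomputable def fixTwoEquiv (K : Type*) [Field K] (m : ℕ) :
    fixTwo K (2 + m) ≃ Matrix (Fin 2) (Fin m) K × Matrix.SpecialLinearGroup (Fin m) K := by
  have key : ∀ P : Matrix.SpecialLinearGroup (Fin (2 + m)) K, P ∈ fixTwo K (2 + m) →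
      (P : Matrix (Fin (2 + m)) (Fin (2 + m)) K).submatrix finSumFinEquiv finSumFinEquiv =
        fromBlocks 1 (of fun i j => P (Fin.castAdd m i) (Fin.natAdd 2 j)) 0
          (of fun i j => P (Fin.natAdd 2 i) (Fin.natAdd 2 j)) := by
    intro P hP
    have h : ∀ (i : Fin (2 + m)) (j : Fin 2), P i (Fin.castAdd m j) =
        if i = Fin.castAdd m j then 1 else 0 := by
      intro i j
      have := congrFun (hP (Fin.castAdd m j) j.isLt) i
      simpa [Pi.single_apply] using this
    ext i j
    rcases i with i | i <;> rcases j with j | j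
    · simp [h, one_apply]
    · simp
    · have : (Fin.natAdd 2 i : Fin (2 + m)) ≠ Fin.castAdd m j := by
        intro hij
        have := congrArg Fin.val hij
        simp at this
        omega
      simp [h, this]
    · simp
  refine
  { toFun P := (of fun i j => P.1 (Fin.castAdd m i) (Fin.natAdd 2 j),
      ⟨of fun i j => P.1 (Fin.natAdd 2 i) (Fin.natAdd 2 j), ?_⟩)
    invFun X := ⟨⟨(fromBlocks 1 X.1 0 (X.2 : Matrix (Fin m) (Fin m) K)).submatrix finSumFinEquiv.symm finSumFinEquiv.symm,
      by rw [det_submatrix_equiv_self, det_fromBlocks_zero₂₁, det_one, one_mul, Matrix.SpecialLinearGroup.det_coe]⟩, ?_⟩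
    left_inv P := ?_
    right_inv X := ?_ }
  · have h := congrArg det (key P.1 P.2)
    rw [det_submatrix_equiv_self, det_fromBlocks_zero₂₁, det_one, one_mul, Matrix.SpecialLinearGroup.det_coe] at h
    exact h.symm
  · intro j hj
    ext i
    rw [Matrix.SpecialLinearGroup.coe_mk]
    obtain ⟨j, rfl⟩ : ∃ j' : Fin 2, j = Fin.castAdd m j' := ⟨⟨j, hj⟩, rfl⟩
    refine Fin.addCases (fun i => ?_) (fun i => ?_) i
    · simp [one_apply, Pi.single_apply]
    · have : (Fin.natAdd 2 i : Fin (2 + m)) ≠ Fin.castAdd m j := by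
        intro hij
        have := congrArg Fin.val hij
        simp at this
        omega
      simp [this]
  · apply Subtype.ext
    apply Subtype.ext
    change submatrix (fromBlocks 1 _ 0 _) _ _ = (P.1 : Matrix (Fin (2 + m)) (Fin (2 + m)) K)
    rw [← key P.1 P.2]
    ext i j
    simp
  · apply Prod.ext
    · ext i j
      simp
    · ext i j
      simp

theorem card_fixTwo (K : Type*) [Field K] [Fintype K] (s : ℕ) (hs : 3 ≤ s) :
    Nat.card (fixTwo K s) = Fintype.card K ^ (s.choose 2 - 1) *
      ∏ i ∈ Finset.Ico 2 (s - 1), (Fintype.card K ^ i - 1) := by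
  obtain ⟨m, rfl⟩ : ∃ m, s = 2 + m := ⟨s - 2, by omega⟩
  have hc : (2 + m).choose 2 - 1 = 2 * m + m.choose 2 := by
    rw [add_comm 2 m, Nat.choose_succ_succ' (m + 1) 1, Nat.choose_succ_succ' m 1]
    simp
    omega
  rw [Nat.card_congr (fixTwoEquiv K m), Nat.card_prod,
    card_specialLinearGroup K m (by omega), hc, pow_add, show 2 + m - 1 = m + 1 by omega,
    ← mul_assoc]
  congr 2
  simp [Matrix, pow_mul, mul_comm 2 m]

/-- The `F`-span of the columns of a square matrix over `E`. -/
def colSpan (F : Type*) {E : Type*} [Field F] [Field E] [Algebra F E] {s : ℕ}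
    (N : Matrix (Fin s) (Fin s) E) : Submodule F (Fin s → E) :=
  LinearMap.range ((Matrix.toLin' N).restrictScalars F ∘ₗ
    (Algebra.linearMap F E).compLeft (Fin s))

section ColSpan

open Matrix

variable {F E : Type*} [Field F] [Field E] [Algebra F E] {s : ℕ}

theorem mem_colSpan {N : Matrix (Fin s) (Fin s) E} {x : Fin s → E} :
    x ∈ colSpan F N ↔ ∃ c : Fin s → F, N *ᵥ (algebraMap F E ∘ c) = x :=
  Iff.rfl

theorem slMap_colSpan (A : Matrix.SpecialLinearGroup (Fin s) E) (N : Matrix (Fin s) (Fin s) E) :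
    slMap F A (colSpan F N) = colSpan F ((A : Matrix (Fin s) (Fin s) E) * N) := by
  ext x
  simp only [slMap, Submodule.mem_map, mem_colSpan, LinearMap.restrictScalars_apply, toLin'_apply]
  constructor
  · rintro ⟨y, ⟨c, rfl⟩, rfl⟩
    exact ⟨c, (mulVec_mulVec _ _ _).symm⟩
  · rintro ⟨c, rfl⟩
    exact ⟨_, ⟨c, rfl⟩, mulVec_mulVec _ _ _⟩

theorem map_mulVec_algebraMap (C : Matrix (Fin s) (Fin s) F) (c : Fin s → F) :
    C.map (algebraMap F E) *ᵥ (algebraMap F E ∘ c) = algebraMap F E ∘ (C *ᵥ c) := by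
  ext i
  simp [RingHom.map_mulVec]

theorem algebraMap_comp_single (j : Fin s) :
    algebraMap F E ∘ (Pi.single j 1 : Fin s → F) = Pi.single j 1 := by
  ext i
  simp [Pi.single_apply, apply_ite (algebraMap F E)]

theorem colSpan_mul_map_le (N : Matrix (Fin s) (Fin s) E) (C : Matrix (Fin s) (Fin s) F) :
    colSpan F (N * C.map (algebraMap F E)) ≤ colSpan F N := by
  rintro x ⟨c, rfl⟩
  refine mem_colSpan.2 ⟨C *ᵥ c, ?_⟩
  rw [← map_mulVec_algebraMap, mulVec_mulVec]
  rfl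

theorem colSpan_mul_map (N : Matrix (Fin s) (Fin s) E)
    (C : Matrix.SpecialLinearGroup (Fin s) F) :
    colSpan F (N * (C : Matrix (Fin s) (Fin s) F).map (algebraMap F E)) = colSpan F N := by
  refine le_antisymm (colSpan_mul_map_le _ _) ?_
  conv_lhs => rw [show N = (N * (C : Matrix (Fin s) (Fin s) F).map (algebraMap F E)) *
    ((C⁻¹ : Matrix.SpecialLinearGroup (Fin s) F) : Matrix (Fin s) (Fin s) F).map
      (algebraMap F E) by
    rw [Matrix.mul_assoc, ← Matrix.map_mul, ← Matrix.SpecialLinearGroup.coe_mul, mul_inv_cancel]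
    simp]
  exact colSpan_mul_map_le _ _

theorem mulVec_algebraMap_injective {N : Matrix (Fin s) (Fin s) E} (hN : N.det ≠ 0) :
    Function.Injective fun c : Fin s → F => N *ᵥ (algebraMap F E ∘ c) :=
  (mulVec_injective_of_isUnit ((isUnit_iff_isUnit_det N).2 hN.isUnit)).comp
    ((algebraMap F E).injective.comp_left)

theorem finrank_colSpan {N : Matrix (Fin s) (Fin s) E} (hN : N.det ≠ 0) :
    Module.finrank F (colSpan F N) = s := by
  have h : Function.Injective ((Matrix.toLin' N).restrictScalars F ∘ₗ
    (Algebra.linearMap F E).compLeft (Fin s)) := mulVec_algebraMap_injective hN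
  rw [colSpan, LinearMap.finrank_range_of_inj h, Module.finrank_fin_fun]

theorem exists_colSpan_of_isFat {U : Submodule F (Fin s → E)} (hU : IsFat F U)
    (hs : Module.finrank F U = s) (hs0 : 0 < s) :
    ∃ N : Matrix (Fin s) (Fin s) E, N.det ≠ 0 ∧ colSpan F N = U := by
  have : Module.Finite F U := Module.finite_of_finrank_pos (hs0.trans_eq hs.symm)
  let b := Module.finBasisOfFinrankEq F U hs
  let v : Fin s → Fin s → E := fun i => (b i : Fin s → E)
  have hspanF : Submodule.span F (Set.range v) = U := by
    have h := congrArg (Submodule.map U.subtype) b.span_eq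
    rw [Submodule.map_span, ← Set.range_comp, Submodule.map_subtype_top] at h
    exact h
  have hspanE : Submodule.span E (U : Set (Fin s → E)) = Submodule.span E (Set.range v) := by
    rw [← hspanF, Submodule.span_span_of_tower]
  have hli : LinearIndependent E v := by
    rw [linearIndependent_iff_card_eq_finrank_span, Set.finrank, ← hspanE, hU, hs,
      Fintype.card_fin]
  refine ⟨(of v)ᵀ, ?_, ?_⟩
  · rw [det_transpose, ← isUnit_iff_ne_zero, ← isUnit_iff_isUnit_det]
    exact linearIndependent_rows_iff_isUnit.1 hli
  · ext x
    rw [mem_colSpan, ← hspanF, Submodule.mem_span_range_iff_exists_fun]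
    refine exists_congr fun c => ?_
    rw [mulVec_transpose, vecMul_eq_sum]
    simp only [Function.comp_apply, algebraMap_smul]
    rfl

theorem exists_linearIndependent_extend {K V : Type*} [Field K] [AddCommGroup V] [Module K V]
    {k : ℕ} (n : ℕ) (hn : k ≤ n) (hV : n ≤ Module.finrank K V) (v : Fin k → V)
    (hv : LinearIndependent K v) :
    ∃ w : Fin n → V, LinearIndependent K w ∧ ∀ i : Fin k, w (Fin.castLE hn i) = v i := by
  induction n, hn using Nat.le_induction with
  | base => exact ⟨v, hv, fun i => rfl⟩
  | succ n hn ih =>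
    obtain ⟨w, hw, hwv⟩ := ih (by omega)
    obtain ⟨x, hx⟩ := exists_linearIndependent_snoc_of_lt_finrank hw (by omega)
    refine ⟨_, hx, fun i => ?_⟩
    rw [← hwv i]
    exact Fin.snoc_castSucc (α := fun _ => V) x w (Fin.castLE hn i)

theorem exists_matrix_det_eq_of_linearIndependent {K : Type*} [Field K] (hs : 3 ≤ s)
    (v : Fin 2 → Fin s → K) (hv : LinearIndependent K v) (d : K) :
    ∃ N : Matrix (Fin s) (Fin s) K, N.det = d ∧
      ∀ (j : Fin s) (hj : j.val < 2), N *ᵥ Pi.single j 1 = v ⟨j, hj⟩ := by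
  obtain ⟨w, hw, hwv⟩ := exists_linearIndependent_extend s (by omega)
    (by rw [Module.finrank_fin_fun]) v hv
  have hdet : (of w)ᵀ.det ≠ 0 := by
    rw [det_transpose, ← isUnit_iff_ne_zero, ← isUnit_iff_isUnit_det]
    exact linearIndependent_rows_iff_isUnit.1 hw
  let last : Fin s := ⟨s - 1, by omega⟩
  refine ⟨(of w)ᵀ.updateCol last ((d / (of w)ᵀ.det) • (of w)ᵀ.col last), ?_, ?_⟩
  · rw [det_updateCol_smul, show (of w)ᵀ.updateCol last ((of w)ᵀ.col last) = (of w)ᵀ from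
      updateCol_eq_self _ _, div_mul_cancel₀ _ hdet]
  · intro j hj
    have hjl : j ≠ last := fun h => by
      have := congrArg Fin.val h
      simp only [last] at this
      omega
    rw [mulVec_single_one, ← hwv ⟨j, hj⟩]
    ext i
    simp [hjl]

theorem mul_map_of_colSpan_le {N N' : Matrix (Fin s) (Fin s) E}
    (h : colSpan F N' ≤ colSpan F N) :
    ∃ C : Matrix (Fin s) (Fin s) F, N' = N * C.map (algebraMap F E) := by
  have h1 : ∀ j, ∃ c : Fin s → F, N *ᵥ (algebraMap F E ∘ c) = N' *ᵥ Pi.single j 1 := fun j =>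
    mem_colSpan.1 (h (mem_colSpan.2 ⟨Pi.single j 1, by rw [algebraMap_comp_single]⟩))
  choose c hc using h1
  refine ⟨(of c)ᵀ, ?_⟩
  ext i j
  have := congrFun (hc j) i
  rw [mulVec_single_one] at this
  exact this.symm

end ColSpan

section Count

open Matrix

variable {F E : Type*} [Field F] [Field E] [Algebra F E] {s : ℕ}

theorem colSpan_mul_eq_iff {N : Matrix (Fin s) (Fin s) E} (hN : N.det ≠ 0)
    {P P' : Matrix.SpecialLinearGroup (Fin s) E} (hP : P ∈ fixTwo E s) (hP' : P' ∈ fixTwo E s) :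
    colSpan F (N * (P : Matrix (Fin s) (Fin s) E)) =
        colSpan F (N * (P' : Matrix (Fin s) (Fin s) E)) ↔
      P⁻¹ * P' ∈ (fixTwo F s).map (Matrix.SpecialLinearGroup.map (algebraMap F E)) := by
  constructor
  · intro h
    obtain ⟨C, hC⟩ := mul_map_of_colSpan_le h.ge
    have hPC : (P' : Matrix (Fin s) (Fin s) E) =
        (P : Matrix (Fin s) (Fin s) E) * C.map (algebraMap F E) := by
      rw [Matrix.mul_assoc] at hC
      exact ((isUnit_iff_isUnit_det N).2 hN.isUnit).mul_left_cancel hC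
    have hdet : C.det = 1 := by
      have h1 := congrArg det hPC
      rw [det_mul, Matrix.SpecialLinearGroup.det_coe, Matrix.SpecialLinearGroup.det_coe, one_mul,
        ← RingHom.mapMatrix_apply, ← RingHom.map_det] at h1
      exact (algebraMap F E).injective (by rw [← h1, map_one])
    have hmap : Matrix.SpecialLinearGroup.map (algebraMap F E) ⟨C, hdet⟩ = P⁻¹ * P' := by
      rw [eq_inv_mul_iff_mul_eq]
      exact Subtype.ext hPC.symm
    refine ⟨⟨C, hdet⟩, ?_, hmap⟩
    intro j hj
    rw [Matrix.SpecialLinearGroup.coe_mk]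
    have h2 := mem_fixTwo.1 (mul_mem (inv_mem hP) hP') j hj
    rw [← hmap] at h2
    change C.map (algebraMap F E) *ᵥ _ = _ at h2
    rw [← algebraMap_comp_single (F := F), map_mulVec_algebraMap] at h2
    exact (algebraMap F E).injective.comp_left h2
  · rintro ⟨C, -, hC⟩
    rw [eq_inv_mul_iff_mul_eq] at hC
    rw [← hC, Matrix.SpecialLinearGroup.coe_mul, ← Matrix.mul_assoc]
    exact (colSpan_mul_map _ C).symm

theorem setOf_orbit_eq_range {M N : Matrix (Fin s) (Fin s) E} (hs : 3 ≤ s) (hM : M.det ≠ 0)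
    (hNM : N.det = M.det) (l : Fin 2 → Fin s → E) (hl : LinearIndependent F l)
    (hN : ∀ (j : Fin s) (hj : j.val < 2), N *ᵥ Pi.single j 1 = l ⟨j, hj⟩) :
    {B | (∃ A, slMap F A (colSpan F M) = B) ∧ Submodule.span F (Set.range l) ≤ B} =
      Set.range fun P : fixTwo E s => colSpan F (N * (P.1 : Matrix (Fin s) (Fin s) E)) := by
  have hN0 : N.det ≠ 0 := hNM ▸ hM
  ext B
  constructor
  · rintro ⟨⟨A, rfl⟩, hlB⟩
    rw [slMap_colSpan] at hlB ⊢
    have hAM : ((A : Matrix (Fin s) (Fin s) E) * M).det = N.det := by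
      rw [det_mul, Matrix.SpecialLinearGroup.det_coe, one_mul, hNM]
    set M' := (A : Matrix (Fin s) (Fin s) E) * M
    have hc : ∀ j, ∃ c : Fin s → F, M' *ᵥ (algebraMap F E ∘ c) = l j := fun j =>
      mem_colSpan.1 (hlB (Submodule.subset_span ⟨j, rfl⟩))
    choose c hc using hc
    have hcli : LinearIndependent F c := by
      refine LinearIndependent.of_comp ((Matrix.toLin' M').restrictScalars F ∘ₗ
        (Algebra.linearMap F E).compLeft (Fin s)) ?_
      convert hl
      ext1 j
      exact hc j
    obtain ⟨C, hC1, hC⟩ := exists_matrix_det_eq_of_linearIndependent hs c hcli 1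
    let C' : Matrix.SpecialLinearGroup (Fin s) F := ⟨C, hC1⟩
    have hNu : IsUnit N.det := hN0.isUnit
    have hCdet : (C.map (algebraMap F E)).det = 1 := by
      rw [← RingHom.mapMatrix_apply, ← RingHom.map_det, hC1, map_one]
    have hPdet : (N⁻¹ * (M' * C.map (algebraMap F E))).det = 1 := by
      rw [det_mul, det_mul, hCdet, mul_one, hAM, ← det_mul, nonsing_inv_mul _ hNu, det_one]
    refine ⟨⟨⟨N⁻¹ * (M' * C.map (algebraMap F E)), hPdet⟩, ?_⟩, ?_⟩
    · intro j hj
      rw [Matrix.SpecialLinearGroup.coe_mk, ← mulVec_mulVec, ← mulVec_mulVec,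
        ← algebraMap_comp_single (F := F), map_mulVec_algebraMap, hC j hj, hc, ← hN j hj,
        mulVec_mulVec, nonsing_inv_mul _ hNu, one_mulVec, algebraMap_comp_single]
    · change colSpan F (N * (N⁻¹ * (M' * C.map (algebraMap F E)))) = _
      rw [← Matrix.mul_assoc, mul_nonsing_inv _ hNu, Matrix.one_mul]
      exact colSpan_mul_map M' C'
  · rintro ⟨P, rfl⟩
    refine ⟨?_, ?_⟩
    · have hMu : IsUnit M.det := hM.isUnit
      refine ⟨⟨N * (P.1 : Matrix (Fin s) (Fin s) E) * M⁻¹, ?_⟩, ?_⟩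
      · rw [det_mul, det_mul, Matrix.SpecialLinearGroup.det_coe, mul_one, hNM, ← det_mul,
          mul_nonsing_inv _ hMu, det_one]
      · refine (slMap_colSpan _ M).trans ?_
        change colSpan F (N * (P.1 : Matrix (Fin s) (Fin s) E) * M⁻¹ * M) = colSpan F _
        rw [Matrix.mul_assoc, nonsing_inv_mul _ hMu, Matrix.mul_one]
    · rw [Submodule.span_le]
      rintro _ ⟨j, rfl⟩
      refine mem_colSpan.2 ⟨Pi.single ⟨j, by omega⟩ 1, ?_⟩
      rw [algebraMap_comp_single, ← mulVec_mulVec, mem_fixTwo.1 P.2 _ j.isLt, hN _ j.isLt]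

theorem ncard_orbit_mul [Fintype F] [Fintype E] {M : Matrix (Fin s) (Fin s) E} (hs : 3 ≤ s)
    (hM : M.det ≠ 0) (l : Fin 2 → Fin s → E) (hl : LinearIndependent E l) :
    {B | (∃ A, slMap F A (colSpan F M) = B) ∧ Submodule.span F (Set.range l) ≤ B}.ncard *
      Nat.card (fixTwo F s) = Nat.card (fixTwo E s) := by
  obtain ⟨N, hNM, hN⟩ := exists_matrix_det_eq_of_linearIndependent hs l hl M.det
  have hN0 : N.det ≠ 0 := hNM ▸ hM
  rw [setOf_orbit_eq_range hs hM hNM l (hl.restrict_scalars' F) hN]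
  let H : Subgroup (fixTwo E s) :=
    ((fixTwo F s).map (Matrix.SpecialLinearGroup.map (algebraMap F E))).subgroupOf (fixTwo E s)
  let Φ : fixTwo E s → Submodule F (Fin s → E) :=
    fun P => colSpan F (N * (P.1 : Matrix (Fin s) (Fin s) E))
  have hΦ : ∀ P P' : fixTwo E s, Φ P = Φ P' ↔ P⁻¹ * P' ∈ H := fun P P' =>
    colSpan_mul_eq_iff hN0 P.2 P'.2
  have hker : Setoid.ker Φ = QuotientGroup.leftRel H := by
    ext P P'
    rw [QuotientGroup.leftRel_apply, ← hΦ]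
    rfl
  have hquot : Nat.card (fixTwo E s ⧸ H) = (Set.range Φ).ncard := by
    rw [← Nat.card_coe_set_eq, ← Nat.card_congr (Setoid.quotientKerEquivRange Φ), hker]
    rfl
  have hle : (fixTwo F s).map (Matrix.SpecialLinearGroup.map (algebraMap F E)) ≤ fixTwo E s := by
    rintro _ ⟨C, hC, rfl⟩ j hj
    change (C : Matrix (Fin s) (Fin s) F).map (algebraMap F E) *ᵥ _ = _
    rw [← algebraMap_comp_single (F := F), map_mulVec_algebraMap, mem_fixTwo.1 hC j hj]
  have hinj : Function.Injective
      (Matrix.SpecialLinearGroup.map (n := Fin s) (algebraMap F E)) := by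
    intro C C' h
    refine Subtype.ext (Matrix.map_injective (algebraMap F E).injective ?_)
    exact congrArg Subtype.val h
  have hH : Nat.card H = Nat.card (fixTwo F s) := by
    rw [Nat.card_congr (Subgroup.subgroupOfEquivOfLe hle).toEquiv,
      ← Nat.card_congr ((fixTwo F s).equivMapOfInjective _ hinj).toEquiv]
  rw [Subgroup.card_eq_card_quotient_mul_card_subgroup H, hquot, hH]

theorem ncard_orbit [Fintype F] [Fintype E] {M : Matrix (Fin s) (Fin s) E} (hs : 3 ≤ s)
    (hM : M.det ≠ 0) (l : Fin 2 → Fin s → E) (hl : LinearIndependent E l) :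
    {B | (∃ A, slMap F A (colSpan F M) = B) ∧ Submodule.span F (Set.range l) ≤ B}.ncard =
      Fintype.card F ^ ((Module.finrank F E - 1) * (s.choose 2 - 1)) *
        ((∏ i ∈ Finset.Ico 2 (s - 1), (Fintype.card F ^ (Module.finrank F E * i) - 1)) /
          ∏ i ∈ Finset.Ico 2 (s - 1), (Fintype.card F ^ i - 1)) := by
  have h := ncard_orbit_mul (F := F) hs hM l hl
  rw [card_fixTwo F s hs, card_fixTwo E s hs, Module.card_eq_pow_finrank (K := F) (V := E)] at h
  have hg : 0 < Module.finrank F E := Module.finrank_pos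
  generalize Module.finrank F E = g at *
  set q := Fintype.card F with hq
  have hq1 : 1 < q := Fintype.one_lt_card
  have hdvd : (∏ i ∈ Finset.Ico 2 (s - 1), (q ^ i - 1)) ∣
      ∏ i ∈ Finset.Ico 2 (s - 1), (q ^ (g * i) - 1) := by
    refine Finset.prod_dvd_prod_of_dvd _ _ fun i _ => ?_
    rw [mul_comm g i, pow_mul]
    exact Nat.sub_one_dvd_pow_sub_one _ _
  have hpos : 0 < ∏ i ∈ Finset.Ico 2 (s - 1), (q ^ i - 1) := by
    refine Finset.prod_pos fun i hi => Nat.sub_pos_of_lt (Nat.one_lt_pow ?_ hq1)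
    have := (Finset.mem_Ico.1 hi).1
    omega
  obtain ⟨t, ht⟩ := hdvd
  simp only [← pow_mul] at h
  rw [ht] at h ⊢
  rw [Nat.mul_div_cancel_left _ hpos]
  have hpow : q ^ (g * (s.choose 2 - 1)) =
      q ^ ((g - 1) * (s.choose 2 - 1)) * q ^ (s.choose 2 - 1) := by
    rw [← pow_add]
    congr 1
    obtain ⟨g, rfl⟩ : ∃ k, g = k + 1 := ⟨g - 1, by omega⟩
    simp
    ring
  rw [hpow] at h
  refine Nat.eq_of_mul_eq_mul_right
    (Nat.mul_pos (pow_pos (by omega : 0 < q) (s.choose 2 - 1)) hpos) ?_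
  rw [h]
  ring

end Count

section Spread

variable {F E : Type*} [Field F] [Field E] [Algebra F E] {s : ℕ}

theorem eq_span_singleton_of_finrank_eq_one {V : Type*} [AddCommGroup V] [Module E V]
    {W : Submodule E V} (hW : Module.finrank E W = 1) {v : V} (hv : v ∈ W) (hv0 : v ≠ 0) :
    W = Submodule.span E {v} := by
  have : Module.Finite E W := Module.finite_of_finrank_eq_succ hW
  refine (Submodule.eq_of_le_of_finrank_eq ?_ ?_).symm
  · rwa [Submodule.span_singleton_le_iff_mem]
  · rw [finrank_span_singleton hv0, hW]

theorem existsUnique_mem_desargSpread {v : Fin s → E} (hv : v ≠ 0) :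
    ∃! S, S ∈ DesargSpread F E s ∧ v ∈ S := by
  refine ⟨(Submodule.span E {v}).restrictScalars F,
    ⟨⟨_, finrank_span_singleton hv, rfl⟩, Submodule.mem_span_singleton_self v⟩, ?_⟩
  rintro _ ⟨⟨W, hW, rfl⟩, hvW⟩
  rw [eq_span_singleton_of_finrank_eq_one hW hvW hv]

theorem isSpread_desargSpread (F E : Type*) [Field F] [Field E] [Algebra F E] (s : ℕ) :
    IsSpread F (Module.finrank F E) (DesargSpread F E s) := by
  constructor
  · rintro _ ⟨W, hW, rfl⟩
    have h := Module.finrank_mul_finrank F E W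
    rw [hW, mul_one] at h
    exact h.symm
  · intro P hP
    obtain ⟨v, hv0, hv⟩ := finrank_eq_one_iff'.1 hP
    have hv' : (v : Fin s → E) ≠ 0 := by simpa using hv0
    have hPv : P = Submodule.span F {(v : Fin s → E)} :=
      eq_span_singleton_of_finrank_eq_one hP v.2 hv'
    simpa only [hPv, Submodule.span_singleton_le_iff_mem] using
      existsUnique_mem_desargSpread (F := F) hv'

theorem one_lt_ncard_desargSpread (F E : Type*) [Field F] [Field E] [Finite E] [Algebra F E]
    {s : ℕ} (hs : 2 ≤ s) : 1 < (DesargSpread F E s).ncard := by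
  have hfin : Finite (Submodule F (Fin s → E)) :=
    Finite.of_injective (fun S => (S : Set (Fin s → E))) SetLike.coe_injective
  rw [Set.one_lt_ncard_iff]
  let i : Fin s := ⟨0, by omega⟩
  let j : Fin s := ⟨1, by omega⟩
  have hij : j ≠ i := by simp [i, j]
  have hne : ∀ k : Fin s, (Pi.single k 1 : Fin s → E) ≠ 0 := fun k => by simp
  refine ⟨(Submodule.span E {Pi.single i 1}).restrictScalars F,
    (Submodule.span E {Pi.single j 1}).restrictScalars F,
    ⟨_, finrank_span_singleton (hne i), rfl⟩, ⟨_, finrank_span_singleton (hne j), rfl⟩, ?_⟩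
  intro h
  have h1 : (Pi.single j 1 : Fin s → E) ∈ (Submodule.span E {Pi.single i 1}).restrictScalars F :=
    h ▸ Submodule.mem_span_singleton_self _
  obtain ⟨t, ht⟩ := Submodule.mem_span_singleton.1 h1
  simpa [hij] using congrFun ht j

open Matrix in
theorem not_forall_mem_colSpan {N : Matrix (Fin s) (Fin s) E} (hN : N.det ≠ 0)
    {S : Submodule F (Fin s → E)} (hS : S ∈ DesargSpread F E s)
    {l : Fin 2 → Fin s → E} (hl : LinearIndependent F l) (hlS : ∀ j, l j ∈ S) :
    ¬ ∀ j, l j ∈ colSpan F N := by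
  intro hlN
  obtain ⟨W, hW, rfl⟩ := hS
  have hW0 : W = Submodule.span E {l 0} :=
    eq_span_singleton_of_finrank_eq_one hW (hlS 0) (hl.ne_zero 0)
  obtain ⟨t, ht⟩ : ∃ t : E, t • l 0 = l 1 := by
    have h1 : l 1 ∈ W := hlS 1
    rwa [hW0, Submodule.mem_span_singleton] at h1
  obtain ⟨c, hc⟩ := mem_colSpan.1 (hlN 0)
  obtain ⟨c', hc'⟩ := mem_colSpan.1 (hlN 1)
  have hcc : t • (algebraMap F E ∘ c) = algebraMap F E ∘ c' := by
    apply mulVec_injective_of_isUnit ((isUnit_iff_isUnit_det N).2 hN.isUnit)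
    rw [mulVec_smul, hc, hc', ht]
  obtain ⟨i, hi⟩ : ∃ i, c i ≠ 0 := by
    by_contra! h
    have : c = 0 := funext h
    refine hl.ne_zero 0 ?_
    rw [← hc, this]
    ext
    simp [mulVec, dotProduct]
  have hti : t * algebraMap F E (c i) = algebraMap F E (c' i) := congrFun hcc i
  have hci : algebraMap F E (c i) ≠ 0 := by simpa using hi
  have htF : t = algebraMap F E (c' i / c i) := by
    rw [map_div₀, ← hti, mul_div_cancel_right₀ _ hci]
  rw [htF, algebraMap_smul] at ht
  have hl01 : l = ![l 0, l 1] := by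
    ext j
    fin_cases j <;> rfl
  rw [hl01] at hl
  exact (LinearIndependent.pair_iff' (hl.ne_zero 0)).1 hl _ ht

theorem linearIndependent_of_not_le_desargSpread {l : Fin 2 → Fin s → E}
    (hl : LinearIndependent F l)
    (h : ¬ ∃ S ∈ DesargSpread F E s, Submodule.span F (Set.range l) ≤ S) :
    LinearIndependent E l := by
  have hl01 : l = ![l 0, l 1] := by
    ext j
    fin_cases j <;> rfl
  rw [hl01, LinearIndependent.pair_iff' (hl.ne_zero 0)]
  intro t ht
  refine h ⟨_, ⟨Submodule.span E {l 0}, finrank_span_singleton (hl.ne_zero 0), rfl⟩, ?_⟩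
  rw [Submodule.span_le]
  rintro _ ⟨j, rfl⟩
  refine Submodule.mem_span_singleton.2 ?_
  fin_cases j
  · exact ⟨1, one_smul _ _⟩
  · exact ⟨t, ht⟩

theorem slMap_mul (A A' : Matrix.SpecialLinearGroup (Fin s) E) (U : Submodule F (Fin s → E)) :
    slMap F (A * A') U = slMap F A (slMap F A' U) := by
  rw [slMap, slMap, slMap, ← Submodule.map_comp, Matrix.SpecialLinearGroup.coe_mul,
    Matrix.toLin'_mul]
  rfl

theorem slMap_one (U : Submodule F (Fin s → E)) :
    slMap F (1 : Matrix.SpecialLinearGroup (Fin s) E) U = U := by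
  rw [slMap, Matrix.SpecialLinearGroup.coe_one, Matrix.toLin'_one]
  exact Submodule.map_id U

end Spread

theorem stmt_15 (F E : Type) [Field F] [Fintype F] [Field E] [Fintype E] [Algebra F E]
    (g s : ℕ) (hg : 2 ≤ g) (hs : 3 ≤ s) (hFE : Module.finrank F E = g)
    (α : ℕ) (hα1 : 1 ≤ α) (hα2 : α ≤ ((Fintype.card F) ^ g - 1) / (Fintype.card F - 1))
    (ℬ : Set (Submodule F (Fin s → E)))
    (hB : ∃ R : Finset (Submodule F (Fin s → E)), R.card = α ∧
      (∀ U ∈ R, IsFat F U ∧ Module.finrank F U = s) ∧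
      (∀ U ∈ R, ∀ U' ∈ R, U ≠ U' →
        ¬ ∃ A : Matrix.SpecialLinearGroup (Fin s) E, slMap F A U = U') ∧
      ℬ = {W | ∃ U ∈ R, ∃ A : Matrix.SpecialLinearGroup (Fin s) E, slMap F A U = W}) :
    IsGDD F g s
      (α * (Fintype.card F) ^ ((g - 1) * (Nat.choose s 2 - 1)) *
        ((∏ i ∈ Finset.Ico 2 (s - 1), ((Fintype.card F) ^ (g * i) - 1)) /
          ∏ i ∈ Finset.Ico 2 (s - 1), ((Fintype.card F) ^ i - 1)))
      (DesargSpread F E s) ℬ := by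
  obtain ⟨R, hRα, hRfat, hRdisj, rfl⟩ := hB
  subst hFE
  have hN : ∀ U ∈ R, ∃ N : Matrix (Fin s) (Fin s) E, N.det ≠ 0 ∧ colSpan F N = U := fun U hU =>
    exists_colSpan_of_isFat (hRfat U hU).1 (hRfat U hU).2 (by omega)
  have hblock : ∀ U ∈ R, ∀ A, ∃ N : Matrix (Fin s) (Fin s) E, N.det ≠ 0 ∧
      slMap F A U = colSpan F N := by
    intro U hU A
    obtain ⟨N, hN0, rfl⟩ := hN U hU
    exact ⟨_, by rwa [Matrix.det_mul, Matrix.SpecialLinearGroup.det_coe, one_mul],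
      slMap_colSpan A N⟩
  refine ⟨isSpread_desargSpread F E s, one_lt_ncard_desargSpread F E (by omega), ?_, ?_⟩
  · rintro _ ⟨U, hU, A, rfl⟩
    obtain ⟨N, hN0, h⟩ := hblock U hU A
    rw [h, finrank_colSpan hN0]
  intro L hL
  have : Module.Finite F L := Module.finite_of_finrank_eq_succ hL
  let b := Module.finBasisOfFinrankEq F L hL
  let l : Fin 2 → Fin s → E := fun j => (b j : Fin s → E)
  have hl : LinearIndependent F l := b.linearIndependent.map' L.subtype (Submodule.ker_subtype L)
  have hlL : Submodule.span F (Set.range l) = L := by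
    have h := congrArg (Submodule.map L.subtype) b.span_eq
    rw [Submodule.map_span, ← Set.range_comp, Submodule.map_subtype_top] at h
    exact h
  constructor
  · rintro ⟨S, hS, hLS⟩
    constructor
    · refine ⟨S, ⟨hS, hLS⟩, fun S' hS' => ?_⟩
      exact (existsUnique_mem_desargSpread (F := F) (hl.ne_zero 0)).unique
        ⟨hS'.1, hS'.2 (b 0).2⟩ ⟨hS, hLS (b 0).2⟩
    · rintro _ ⟨U, hU, A, rfl⟩ hLB
      obtain ⟨N, hN0, h⟩ := hblock U hU A
      exact not_forall_mem_colSpan hN0 hS hl (fun j => hLS (b j).2) fun j => h ▸ hLB (b j).2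
  · intro hLS
    rw [← hlL] at hLS ⊢
    have hlE := linearIndependent_of_not_le_desargSpread hl hLS
    have hfin : Finite (Submodule F (Fin s → E)) :=
      Finite.of_injective (fun S => (S : Set (Fin s → E))) SetLike.coe_injective
    classical
    have := Fintype.ofFinite (Submodule F (Fin s → E))
    let T : Submodule F (Fin s → E) → Set (Submodule F (Fin s → E)) := fun U =>
      {B | (∃ A, slMap F A U = B) ∧ Submodule.span F (Set.range l) ≤ B}
    have hunion : {B | B ∈ {W | ∃ U ∈ R, ∃ A : Matrix.SpecialLinearGroup (Fin s) E,
        slMap F A U = W} ∧ Submodule.span F (Set.range l) ≤ B} =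
        ((R.biUnion fun U => (T U).toFinset : Finset _) : Set (Submodule F (Fin s → E))) := by
      ext B
      simp only [Set.mem_ofPred_eq, Finset.coe_biUnion, Set.coe_toFinset, Set.mem_iUnion, T,
        Finset.mem_coe, exists_prop]
      constructor
      · rintro ⟨⟨U, hU, hA⟩, hB⟩
        exact ⟨U, hU, hA, hB⟩
      · rintro ⟨U, hU, hA, hB⟩
        exact ⟨⟨U, hU, hA⟩, hB⟩
    rw [hunion, Set.ncard_coe_finset, Finset.card_biUnion, ← hRα, mul_assoc, ← smul_eq_mul,
      ← Finset.sum_const]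
    · refine Finset.sum_congr rfl fun U hU => ?_
      obtain ⟨N, hN0, rfl⟩ := hN U hU
      rw [← Set.ncard_eq_toFinset_card']
      exact ncard_orbit hs hN0 l hlE
    · intro U hU U' hU' hne
      refine Finset.disjoint_left.2 fun B hB hB' => ?_
      simp only [Set.mem_toFinset, T, Set.mem_ofPred_eq] at hB hB'
      obtain ⟨⟨A, hA⟩, -⟩ := hB
      obtain ⟨⟨A', hA'⟩, -⟩ := hB'
      refine hRdisj U hU U' hU' hne ⟨A'⁻¹ * A, ?_⟩
      rw [slMap_mul, hA, ← hA', ← slMap_mul, inv_mul_cancel, slMap_one]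
end
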